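/- Let (Σ_m, σ) be the full shift, r ≥ 1, and Φ(x^{(1)},…,x^{(r)}) = φ_1(x^{(1)}_1, x^{(1)}_2) ⋯ φ_r(x^{(r)}_1, x^{(r)}_2) where each φ_k : {0,…,m−1}^2 → ℝ. For a probability vector p and a stochastic matrix P = (p_{i,j}) with pP = p, the Markov measure μ_{p,P} satisfies A(p,P) := ∫_{Σ_m^r} Φ d(μ_{p,P})^{⊗r} = Π_{k=1}^r Σ_{i,j=0}^{m−1} φ_k(i,j) p_i p_{i,j}; moreover, for every α with E_Φ(α) ≠ ∅, h_top(E_Φ(α)) = max{ H_2(p,P) : A(p,P) = α }, where H_2(p,P) = −Σ_{i=0}^{m−1} p_i Σ_{j=0}^{m−1} p_{i,j} log p_{i,j}. -/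

import Mathlib

open MeasureTheory Filter Topology
open scoped ENNReal NNReal

section Defs

variable {X : Type*} [MetricSpace X]

/-- The Bowen ball `B_n(x, ε)` for the dynamics `T`. -/
def bowenBall (T : X → X) (n : ℕ) (ε : ℝ) (x : X) : Set X :=
  {y | ∀ j < n, dist (T^[j] x) (T^[j] y) < ε}

/-- `H^s_n(Z, ε)`: infimum of `∑ exp(-s n_i)` over countable covers of `Z` by Bowen balls
`B_{n_i}(x_i, ε)` with `n_i ≥ n`. -/
noncomputable def bowenHn (T : X → X) (Z : Set X) (s ε : ℝ) (n : ℕ) : ℝ≥0∞ :=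
  ⨅ (c : ℕ → X × ℕ) (_ : Z ⊆ ⋃ i, bowenBall T (c i).2 ε (c i).1) (_ : ∀ i, n ≤ (c i).2),
    ∑' i, ENNReal.ofReal (Real.exp (-(s * ((c i).2 : ℝ))))

/-- `H^s(Z, ε) = lim_n H^s_n(Z, ε)` (the quantities are nondecreasing in `n`). -/
noncomputable def bowenH (T : X → X) (Z : Set X) (s ε : ℝ) : ℝ≥0∞ :=
  ⨆ n : ℕ, bowenHn T Z s ε n

/-- `h_top(Z, ε)`: the critical value of `s ↦ H^s(Z, ε)`. -/
noncomputable def bowenEnt (T : X → X) (Z : Set X) (ε : ℝ) : ℝ≥0∞ :=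
  ⨅ (s : ℝ≥0) (_ : bowenH T Z s ε = 0), (s : ℝ≥0∞)

/-- Bowen's topological entropy of an arbitrary subset `Z ⊆ X`:
`h_top(Z) = lim_{ε → 0} h_top(Z, ε)`. -/
noncomputable def htop (T : X → X) (Z : Set X) : ℝ≥0∞ :=
  ⨆ (ε : ℝ) (_ : 0 < ε), bowenEnt T Z ε

variable [MeasurableSpace X]

/-- Shannon entropy of the finite measurable partition of `X` induced by `P : X → ι`. -/
noncomputable def partEntropy {ι : Type} [Fintype ι] (μ : Measure X) (P : X → ι) : ℝ :=
  ∑ i : ι, Real.negMulLog ((μ (P ⁻¹' {i})).toReal)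

/-- The measure-theoretic (Kolmogorov–Sinai) entropy `h_μ(T)`: supremum over finite measurable
partitions `P` of `lim_n (1/n) H_μ(P ∨ T⁻¹P ∨ ⋯ ∨ T^{-(n-1)}P)`, the limit being the
infimum by subadditivity. -/
noncomputable def hKS (T : X → X) (μ : Measure X) : ℝ≥0∞ :=
  ⨆ (k : ℕ) (P : X → Fin k) (_ : Measurable P),
    ENNReal.ofReal (⨅ n : ℕ,
      partEntropy μ (fun x => fun j : Fin (n + 1) => P (T^[(j : ℕ)] x)) / (n + 1))

/-- The V-statistics `V_Φ(n, x) = n^{-r} ∑_{1 ≤ i_1, …, i_r ≤ n} Φ(T^{i_1}x, …, T^{i_r}x)`. -/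
noncomputable def Vstat {r : ℕ} (T : X → X) (Φ : (Fin r → X) → ℝ) (n : ℕ) (x : X) : ℝ :=
  (∑ i : Fin r → Fin n, Φ (fun j => T^[(i j : ℕ) + 1] x)) / (n : ℝ) ^ r

/-- The level set `E_Φ(α) = {x : lim_n V_Φ(n,x) = α}`. -/
def Eset {r : ℕ} (T : X → X) (Φ : (Fin r → X) → ℝ) (α : ℝ) : Set X :=
  {x | Tendsto (fun n => Vstat T Φ n x) atTop (𝓝 α)}

/-- The fiber `M_Φ(α)`: the `T`-invariant Borel probability measures `μ` with
`∫_{X^r} Φ dμ^{⊗r} = α`. -/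
def Mset {r : ℕ} (T : X → X) (Φ : (Fin r → X) → ℝ) (α : ℝ) : Set (Measure X) :=
  {μ | IsProbabilityMeasure μ ∧ MeasurePreserving T μ μ ∧
    ∫ y, Φ y ∂(Measure.pi fun _ : Fin r => μ) = α}

end Defs

section Shift

/- The metric `d(x,y) = (1/2)^{min {n : x_n ≠ y_n}}` on the symbolic space
`Σ_m = {0, …, m-1}^ℕ`; its topology is the product topology. -/
attribute [local instance] PiNat.metricSpace

/-- The shift map `σ` on `Σ_m = {0, …, m-1}^ℕ`. -/
def shift (m : ℕ) : (ℕ → Fin m) → (ℕ → Fin m) := fun x n => x (n + 1)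

/-! ### Path sums and path weights along lists -/

section Paths

variable {m : ℕ}

/-- Sum of `f` over consecutive pairs of the word `a :: l`. -/
def pathS (f : Fin m → Fin m → ℝ) : Fin m → List (Fin m) → ℝ
  | _, [] => 0
  | a, b :: l => f a b + pathS f b l

/-- Product of `Q` over consecutive pairs of the word `a :: l`. -/
def pathW (Q : Fin m → Fin m → ℝ) : Fin m → List (Fin m) → ℝ
  | _, [] => 1
  | a, b :: l => Q a b * pathW Q b l

/-- Pair sum of a word. -/
def lS (f : Fin m → Fin m → ℝ) : List (Fin m) → ℝ
  | [] => 0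
  | a :: l => pathS f a l

/-- Indicator of the pair `(i, j)`. -/
def indP (i j : Fin m) : Fin m → Fin m → ℝ := fun a b => if a = i ∧ b = j then 1 else 0

/-- Number of occurrences of the pair `(i, j)` in the word `a :: l`. -/
def pathN (i j : Fin m) : Fin m → List (Fin m) → ℕ
  | _, [] => 0
  | a, b :: l => (if a = i ∧ b = j then 1 else 0) + pathN i j b l

lemma indP_nonneg (i j a b : Fin m) : 0 ≤ indP i j a b := by
  unfold indP; split_ifs <;> norm_num

lemma indP_le_one (i j a b : Fin m) : indP i j a b ≤ 1 := by
  unfold indP; split_ifs <;> norm_num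

lemma sum_indP (f : Fin m → Fin m → ℝ) (a b : Fin m) :
    ∑ i, ∑ j, f i j * indP i j a b = f a b := by
  rw [Finset.sum_eq_single a, Finset.sum_eq_single b]
  · simp [indP]
  · intro j _ hj; simp [indP, Ne.symm hj]
  · simp
  · intro i _ hi; simp [indP, Ne.symm hi]
  · simp

lemma pathN_eq (i j a : Fin m) (l : List (Fin m)) :
    (pathN i j a l : ℝ) = pathS (indP i j) a l := by
  induction l generalizing a with
  | nil => simp [pathN, pathS]
  | cons b l ih => simp only [pathN, pathS, Nat.cast_add, ih, indP]; split_ifs <;> simp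

lemma pathN_le (i j a : Fin m) (l : List (Fin m)) : pathN i j a l ≤ l.length := by
  induction l generalizing a with
  | nil => simp [pathN]
  | cons b l ih =>
    simp only [pathN, List.length_cons]
    have := ih b
    split_ifs <;> omega

lemma pathS_eq_sum (f : Fin m → Fin m → ℝ) (a : Fin m) (l : List (Fin m)) :
    pathS f a l = ∑ i, ∑ j, f i j * pathS (indP i j) a l := by
  induction l generalizing a with
  | nil => simp [pathS]
  | cons b l ih =>
    simp only [pathS, mul_add, Finset.sum_add_distrib, sum_indP]
    rw [ih b]

lemma pathS_nonneg {f : Fin m → Fin m → ℝ} (hf : ∀ a b, 0 ≤ f a b) (a : Fin m)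
    (l : List (Fin m)) : 0 ≤ pathS f a l := by
  induction l generalizing a with
  | nil => simp [pathS]
  | cons b l ih => exact add_nonneg (hf a b) (ih b)

lemma pathS_le {f : Fin m → Fin m → ℝ} (hf : ∀ a b, f a b ≤ 1) (a : Fin m)
    (l : List (Fin m)) : pathS f a l ≤ l.length := by
  induction l generalizing a with
  | nil => simp [pathS]
  | cons b l ih =>
    simp only [pathS, List.length_cons, Nat.cast_add, Nat.cast_one]
    linarith [hf a b, ih b]

lemma pathS_one (a : Fin m) (l : List (Fin m)) :
    ∑ i, ∑ j, pathS (indP i j) a l = l.length := by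
  have h1 : pathS (fun _ _ : Fin m => (1 : ℝ)) a l = l.length := by
    induction l generalizing a with
    | nil => simp [pathS]
    | cons b l ih => simp [pathS, ih, add_comm]
  rw [← h1, pathS_eq_sum (fun _ _ => 1)]
  simp

lemma pathW_nonneg {Q : Fin m → Fin m → ℝ} (hQ : ∀ a b, 0 ≤ Q a b) (a : Fin m)
    (l : List (Fin m)) : 0 ≤ pathW Q a l := by
  induction l generalizing a with
  | nil => simp [pathW]
  | cons b l ih => exact mul_nonneg (hQ a b) (ih b)

lemma pathW_le_exp {Q : Fin m → Fin m → ℝ} (hQ : ∀ a b, 0 ≤ Q a b) (a : Fin m)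
    (l : List (Fin m)) : pathW Q a l ≤ Real.exp (pathS (fun i j => Real.log (Q i j)) a l) := by
  induction l generalizing a with
  | nil => simp [pathW, pathS]
  | cons b l ih =>
    simp only [pathW, pathS, Real.exp_add]
    exact mul_le_mul (Real.le_exp_log _) (ih b) (pathW_nonneg hQ b l) (Real.exp_pos _).le

lemma pathW_eq_exp {Q : Fin m → Fin m → ℝ} (a : Fin m) (l : List (Fin m))
    (hQ : ∀ i j, 0 < pathN i j a l → 0 < Q i j) :
    pathW Q a l = Real.exp (pathS (fun i j => Real.log (Q i j)) a l) := by
  induction l generalizing a with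
  | nil => simp [pathW, pathS]
  | cons b l ih =>
    simp only [pathW, pathS, Real.exp_add]
    rw [Real.exp_log (hQ a b (by simp [pathN])), ih b]
    intro i j h
    exact hQ i j (by simp only [pathN]; omega)

lemma sum_fin_cons {A : Type*} [Fintype A] (n : ℕ) (F : (Fin (n + 1) → A) → ℝ) :
    ∑ w, F w = ∑ a : A, ∑ v : Fin n → A, F (Fin.cons a v) := by
  rw [← (Fin.consEquiv (fun _ : Fin (n + 1) => A)).sum_comp, Fintype.sum_prod_type]
  rfl

lemma sum_pathW_le {Q : Fin m → Fin m → ℝ} (hQ : ∀ a b, 0 ≤ Q a b)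
    (hQ1 : ∀ a, ∑ b, Q a b ≤ 1) (n : ℕ) (a : Fin m) :
    ∑ w : Fin n → Fin m, pathW Q a (List.ofFn w) ≤ 1 := by
  induction n generalizing a with
  | zero => simp [pathW]
  | succ n ih =>
    rw [sum_fin_cons]
    simp only [List.ofFn_cons, pathW, ← Finset.mul_sum]
    refine le_trans (Finset.sum_le_sum fun b _ => ?_) (hQ1 a)
    exact mul_le_of_le_one_right (hQ a b) (ih b)

lemma sum_pathW_eq {Q : Fin m → Fin m → ℝ}
    (hQ1 : ∀ a, ∑ b, Q a b = 1) (n : ℕ) (a : Fin m) :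
    ∑ w : Fin n → Fin m, pathW Q a (List.ofFn w) = 1 := by
  induction n generalizing a with
  | zero => simp [pathW]
  | succ n ih =>
    rw [sum_fin_cons]
    simp only [List.ofFn_cons, pathW, ← Finset.mul_sum, ih, mul_one, hQ1]

/-- Stationarity: the expected pair sum. -/
lemma sum_pathW_pathS {p : Fin m → ℝ} {P : Fin m → Fin m → ℝ}
    (hP1 : ∀ a, ∑ b, P a b = 1) (hst : ∀ j, ∑ i, p i * P i j = p j)
    (f : Fin m → Fin m → ℝ) (n : ℕ) :
    ∑ a, p a * ∑ w : Fin n → Fin m, pathW P a (List.ofFn w) * pathS f a (List.ofFn w)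
      = n * ∑ i, ∑ j, f i j * (p i * P i j) := by
  induction n with
  | zero => simp [pathS]
  | succ n ih =>
    have key : ∀ a, p a * ∑ w : Fin (n + 1) → Fin m,
        pathW P a (List.ofFn w) * pathS f a (List.ofFn w)
        = ∑ b, f a b * (p a * P a b) + ∑ b, p a * P a b *
          ∑ w : Fin n → Fin m, pathW P b (List.ofFn w) * pathS f b (List.ofFn w) := by
      intro a
      rw [sum_fin_cons, Finset.mul_sum, ← Finset.sum_add_distrib]
      refine Finset.sum_congr rfl fun b _ => ?_
      have h1 := sum_pathW_eq hP1 n b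
      simp only [List.ofFn_cons, pathW, pathS, mul_add, Finset.sum_add_distrib]
      have e1 : ∑ w : Fin n → Fin m, P a b * pathW P b (List.ofFn w) * f a b
          = P a b * f a b := by
        rw [← Finset.sum_mul, ← Finset.mul_sum, h1]; ring
      have e2 : ∑ w : Fin n → Fin m, P a b * pathW P b (List.ofFn w) * pathS f b (List.ofFn w)
          = P a b * ∑ w : Fin n → Fin m, pathW P b (List.ofFn w) * pathS f b (List.ofFn w) := by
        rw [Finset.mul_sum]; exact Finset.sum_congr rfl fun _ _ => by ring
      rw [e1, e2]; ring
    simp only [key, Finset.sum_add_distrib]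
    rw [Finset.sum_comm (f := fun a b => p a * P a b * _)]
    simp only [← Finset.sum_mul, hst, ih]
    push_cast; ring

lemma pathS_seq (f : Fin m → Fin m → ℝ) (x : ℕ → Fin m) (n : ℕ) :
    pathS f (x 0) (List.ofFn fun i : Fin n => x (i + 1)) =
      ∑ t ∈ Finset.range n, f (x t) (x (t + 1)) := by
  induction n generalizing x with
  | zero => simp [pathS]
  | succ n ih =>
    rw [List.ofFn_succ, Finset.sum_range_succ']
    simp only [pathS]
    have := ih (fun k => x (k + 1))
    simp only [zero_add] at this
    simp only [Fin.val_zero, zero_add, Fin.val_succ]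
    rw [this]; ring

lemma lS_append {f : Fin m → Fin m → ℝ} (h0 : ∀ a b, 0 ≤ f a b) (h1 : ∀ a b, f a b ≤ 1)
    (l l' : List (Fin m)) : |lS f (l ++ l') - lS f l - lS f l'| ≤ 1 := by
  have key : ∀ (l' l : List (Fin m)) (a : Fin m),
      |pathS f a (l ++ l') - pathS f a l - lS f l'| ≤ 1 := by
    intro l' l
    induction l with
    | nil =>
      intro a
      cases l' with
      | nil => simp [pathS, lS]
      | cons b l' =>
        simp only [List.nil_append, pathS, lS]
        rw [abs_le]; constructor <;> linarith [h0 a b, h1 a b]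
    | cons b l ih =>
      intro a
      simp only [List.cons_append, pathS]
      have := ih b
      rw [show f a b + pathS f b (l ++ l') - (f a b + pathS f b l) - lS f l'
        = pathS f b (l ++ l') - pathS f b l - lS f l' by ring]
      exact this
  cases l with
  | nil => simp [lS]
  | cons a l => exact key l' l a

lemma lS_flatten {f : Fin m → Fin m → ℝ} (h0 : ∀ a b, 0 ≤ f a b) (h1 : ∀ a b, f a b ≤ 1)
    (ls : List (List (Fin m))) : |lS f ls.flatten - (ls.map (lS f)).sum| ≤ ls.length := by
  induction ls with
  | nil => simp [lS]
  | cons l ls ih =>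
    simp only [List.flatten_cons, List.map_cons, List.sum_cons, List.length_cons, Nat.cast_add,
      Nat.cast_one]
    have h := lS_append h0 h1 l ls.flatten
    rw [abs_le] at *
    constructor <;> linarith [h.1, h.2, ih.1, ih.2]

lemma lS_nonneg {f : Fin m → Fin m → ℝ} (h0 : ∀ a b, 0 ≤ f a b) (l : List (Fin m)) :
    0 ≤ lS f l := by
  cases l with
  | nil => simp [lS]
  | cons a l => exact pathS_nonneg h0 a l

lemma lS_le {f : Fin m → Fin m → ℝ} (h1 : ∀ a b, f a b ≤ 1) (l : List (Fin m)) :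
    lS f l ≤ l.length := by
  cases l with
  | nil => simp [lS]
  | cons a l =>
    have := pathS_le h1 a l
    simp only [lS, List.length_cons, Nat.cast_add, Nat.cast_one]; linarith

/-- Second moment of an i.i.d. centered sum. -/
lemma sum_iid {A : Type*} [Fintype A] (ν g : A → ℝ) (h1 : ∑ a, ν a = 1)
    (hg : ∑ a, ν a * g a = 0) (n : ℕ) :
    (∑ w : Fin n → A, ∏ i, ν (w i) = 1) ∧
    (∑ w : Fin n → A, (∏ i, ν (w i)) * (∑ i, g (w i)) = 0) ∧
    (∑ w : Fin n → A, (∏ i, ν (w i)) * (∑ i, g (w i)) ^ 2 = n * ∑ a, ν a * g a ^ 2) := by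
  induction n with
  | zero => simp
  | succ n ih =>
    obtain ⟨i1, i2, i3⟩ := ih
    simp only [sum_fin_cons, Fin.prod_univ_succ, Fin.sum_univ_succ, Fin.cons_zero, Fin.cons_succ]
    refine ⟨?_, ?_, ?_⟩
    · simp only [← Finset.mul_sum, i1, mul_one, h1]
    · have : ∀ a, ∑ w : Fin n → A, (ν a * ∏ i, ν (w i)) * (g a + ∑ i, g (w i))
          = ν a * g a := by
        intro a
        have : ∀ w : Fin n → A, (ν a * ∏ i, ν (w i)) * (g a + ∑ i, g (w i))
          = (ν a * g a) * (∏ i, ν (w i)) + ν a * ((∏ i, ν (w i)) * (∑ i, g (w i))) := by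
          intro w; ring
        simp only [this, Finset.sum_add_distrib, ← Finset.mul_sum, i1, i2]; ring
      simp only [this, hg]
    · have : ∀ a, ∑ w : Fin n → A, (ν a * ∏ i, ν (w i)) * (g a + ∑ i, g (w i)) ^ 2
          = ν a * g a ^ 2 + ν a * (n * ∑ a, ν a * g a ^ 2) := by
        intro a
        have : ∀ w : Fin n → A, (ν a * ∏ i, ν (w i)) * (g a + ∑ i, g (w i)) ^ 2
          = (ν a * g a ^ 2) * (∏ i, ν (w i))
            + (2 * ν a * g a) * ((∏ i, ν (w i)) * (∑ i, g (w i)))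
            + ν a * ((∏ i, ν (w i)) * (∑ i, g (w i)) ^ 2) := by
          intro w; ring
        simp only [this, Finset.sum_add_distrib, ← Finset.mul_sum, i1, i2, i3]; ring
      simp only [this, Finset.sum_add_distrib, ← Finset.sum_mul, h1]
      push_cast; ring

end Paths

section Words

variable {m : ℕ}

/-- Entropy of a Markov chain. -/
noncomputable def H2 (p : Fin m → ℝ) (P : Fin m → Fin m → ℝ) : ℝ :=
  ∑ i : Fin m, p i * ∑ j : Fin m, Real.negMulLog (P i j)

lemma H2_nonneg {p : Fin m → ℝ} {P : Fin m → Fin m → ℝ} (hp : ∀ i, 0 ≤ p i)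
    (hP : ∀ i j, 0 ≤ P i j) (hP1 : ∀ i, ∑ j, P i j = 1) : 0 ≤ H2 p P := by
  refine Finset.sum_nonneg fun i _ => mul_nonneg (hp i) (Finset.sum_nonneg fun j _ => ?_)
  refine Real.negMulLog_nonneg (hP i j) ?_
  rw [← hP1 i]
  exact Finset.single_le_sum (fun k _ => hP i k) (Finset.mem_univ j)

/-- The word associated to a block. -/
def blk {j : ℕ} (b : Fin m × (Fin j → Fin m)) : List (Fin m) := b.1 :: List.ofFn b.2

/-- The word associated to a sequence of blocks. -/
def sblk {j N : ℕ} (w : Fin N → Fin m × (Fin j → Fin m)) : List (Fin m) :=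
  (List.ofFn fun i => blk (w i)).flatten

lemma blk_inj {j : ℕ} : Function.Injective (blk (m := m) (j := j)) := by
  rintro ⟨a, v⟩ ⟨b, w⟩ h
  simp only [blk, List.cons.injEq, List.ofFn_inj] at h
  exact Prod.ext h.1 h.2

lemma blk_length {j : ℕ} (b : Fin m × (Fin j → Fin m)) : (blk b).length = j + 1 := by
  simp [blk]

lemma sblk_inj {j N : ℕ} : Function.Injective (sblk (m := m) (j := j) (N := N)) := by
  intro v w h
  have h2 : (List.ofFn fun i => blk (v i)) = (List.ofFn fun i => blk (w i)) := by
    rw [List.eq_iff_flatten_eq]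
    refine ⟨h, ?_⟩
    simp only [List.map_ofFn]
    congr 1
    funext i
    simp [blk_length]
  rw [List.ofFn_inj] at h2
  funext i
  exact blk_inj (congrFun h2 i)

lemma sblk_length {j N : ℕ} (w : Fin N → Fin m × (Fin j → Fin m)) :
    (sblk w).length = N * (j + 1) := by
  simp only [sblk, List.length_flatten, List.map_ofFn]
  rw [show (List.length ∘ fun i => blk (w i)) = fun _ => j + 1 from funext fun i => by
    simp [blk_length]]
  simp

lemma good_words {p : Fin m → ℝ} {P : Fin m → Fin m → ℝ}
    (hp : ∀ i, 0 ≤ p i) (hp1 : ∑ i, p i = 1)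
    (hP : ∀ i j, 0 ≤ P i j) (hP1 : ∀ i, ∑ j, P i j = 1)
    (hst : ∀ j, ∑ i, p i * P i j = p j) (j : ℕ) (hj : 2 * (m : ℝ) ^ 2 ≤ j + 1) :
    ∃ W : Finset (List (Fin m)), W.Nonempty ∧ (∀ w ∈ W, w.length = (j + 1) ^ 4) ∧
      (∀ w ∈ W, ∀ a b, |lS (indP a b) w - ((j : ℝ) + 1) ^ 4 * (p a * P a b)|
        ≤ 3 * ((j : ℝ) + 1) ^ 3) ∧
      ((j : ℝ) + 1) ^ 4 * H2 p P - (H2 p P + (∑ a, ∑ b, |Real.log (P a b)|) + 1)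
        * ((j : ℝ) + 1) ^ 3 ≤ Real.log W.card := by
  classical
  set B := Fin m × (Fin j → Fin m)
  set N := (j + 1) ^ 3 with hN
  have hNr : (N : ℝ) = ((j : ℝ) + 1) ^ 3 := by simp [hN]
  have hp_le : ∀ i, p i ≤ 1 := fun i => by
    rw [← hp1]; exact Finset.single_le_sum (fun k _ => hp k) (Finset.mem_univ i)
  have hP_le : ∀ i k, P i k ≤ 1 := fun i k => by
    rw [← hP1 i]; exact Finset.single_le_sum (fun k _ => hP i k) (Finset.mem_univ k)
  have hπ0 : ∀ a b, 0 ≤ p a * P a b := fun a b => mul_nonneg (hp a) (hP a b)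
  have hπ1 : ∀ a b, p a * P a b ≤ 1 := fun a b => mul_le_one₀ (hp_le a) (hP a b) (hP_le a b)
  let ν : B → ℝ := fun b => p b.1 * pathW P b.1 (List.ofFn b.2)
  let S : Fin m → Fin m → B → ℝ := fun a b v => pathS (indP a b) v.1 (List.ofFn v.2)
  let g : Fin m → Fin m → B → ℝ := fun a b v => S a b v - j * (p a * P a b)
  have hν0 : ∀ b, 0 ≤ ν b := fun b => mul_nonneg (hp _) (pathW_nonneg hP _ _)
  have hν1 : ∑ b, ν b = 1 := by
    rw [Fintype.sum_prod_type]
    simp only [ν, ← Finset.mul_sum, sum_pathW_eq hP1, mul_one, hp1]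
  have hS : ∀ a b, ∑ v, ν v * S a b v = j * (p a * P a b) := by
    intro a b
    rw [Fintype.sum_prod_type]
    have := sum_pathW_pathS hP1 hst (indP a b) j
    simp only [ν, S, mul_assoc, ← Finset.mul_sum]
    rw [this]
    congr 1
    rw [Finset.sum_eq_single a, Finset.sum_eq_single b]
    · simp [indP]
    · intro k _ hk; simp [indP, hk]
    · simp
    · intro k _ hk; simp [indP, hk]
    · simp
  have hg : ∀ a b, ∑ v, ν v * g a b v = 0 := by
    intro a b
    simp only [g, mul_sub, Finset.sum_sub_distrib, hS, ← Finset.sum_mul, hν1]; ring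
  have hg2 : ∀ a b v, g a b v ^ 2 ≤ ((j : ℝ) + 1) ^ 2 := by
    intro a b v
    have h0 : 0 ≤ S a b v := pathS_nonneg (indP_nonneg a b) _ _
    have h1 : S a b v ≤ j := by
      have := pathS_le (indP_le_one a b) v.1 (List.ofFn v.2)
      simpa using this
    have hj0 : (0 : ℝ) ≤ j := Nat.cast_nonneg j
    have h2 : (j : ℝ) * (p a * P a b) ≤ j := mul_le_of_le_one_right hj0 (hπ1 a b)
    have h3 : 0 ≤ (j : ℝ) * (p a * P a b) := mul_nonneg hj0 (hπ0 a b)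
    apply sq_le_sq'
    · simp only [g]; linarith
    · simp only [g]; linarith
  have hvar : ∀ a b, ∑ v, ν v * g a b v ^ 2 ≤ ((j : ℝ) + 1) ^ 2 := by
    intro a b
    calc ∑ v, ν v * g a b v ^ 2 ≤ ∑ v, ν v * ((j : ℝ) + 1) ^ 2 :=
          Finset.sum_le_sum fun v _ => mul_le_mul_of_nonneg_left (hg2 a b v) (hν0 v)
      _ = _ := by rw [← Finset.sum_mul, hν1, one_mul]
  let D : Fin m → Fin m → (Fin N → B) → ℝ := fun a b w => ∑ i, g a b (w i)
  let pr : (Fin N → B) → ℝ := fun w => ∏ i, ν (w i)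
  have hpr0 : ∀ w, 0 ≤ pr w := fun w => Finset.prod_nonneg fun i _ => hν0 _
  have hj1 : (0 : ℝ) < (j : ℝ) + 1 := by positivity
  have hED : ∀ a b, ∑ w, pr w * D a b w ^ 2 ≤ ((j : ℝ) + 1) ^ 5 := by
    intro a b
    rw [(sum_iid ν (g a b) hν1 (hg a b) N).2.2, hNr]
    calc ((j : ℝ) + 1) ^ 3 * _ ≤ ((j : ℝ) + 1) ^ 3 * ((j : ℝ) + 1) ^ 2 := by
          gcongr; exact hvar a b
      _ = _ := by ring
  let good : (Fin N → B) → Prop := fun w => ∀ a b, D a b w ^ 2 ≤ (((j : ℝ) + 1) ^ 3) ^ 2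
  let G : Finset (Fin N → B) := Finset.univ.filter good
  have hbad : ∑ w ∈ Finset.univ.filter (fun w => ¬ good w), pr w ≤ 1 / 2 := by
    have h1 : ∀ w, ¬ good w → pr w ≤ pr w * ∑ a, ∑ b, D a b w ^ 2 / ((j : ℝ) + 1) ^ 6 := by
      intro w hw
      simp only [good, not_forall, not_le] at hw
      obtain ⟨a, b, hab⟩ := hw
      apply le_mul_of_one_le_right (hpr0 w)
      calc (1 : ℝ) ≤ D a b w ^ 2 / ((j : ℝ) + 1) ^ 6 := by
            rw [one_le_div (by positivity)]; rw [← pow_mul] at hab; exact hab.le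
        _ ≤ ∑ b, D a b w ^ 2 / ((j : ℝ) + 1) ^ 6 :=
            Finset.single_le_sum (f := fun b => D a b w ^ 2 / ((j : ℝ) + 1) ^ 6)
              (fun _ _ => by positivity) (Finset.mem_univ b)
        _ ≤ _ := Finset.single_le_sum (f := fun a => ∑ b, D a b w ^ 2 / ((j : ℝ) + 1) ^ 6)
              (fun _ _ => Finset.sum_nonneg fun _ _ => by positivity) (Finset.mem_univ a)
    calc ∑ w ∈ Finset.univ.filter (fun w => ¬ good w), pr w
        ≤ ∑ w ∈ Finset.univ.filter (fun w => ¬ good w),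
            pr w * ∑ a, ∑ b, D a b w ^ 2 / ((j : ℝ) + 1) ^ 6 :=
          Finset.sum_le_sum fun w hw => h1 w (Finset.mem_filter.1 hw).2
      _ ≤ ∑ w, pr w * ∑ a, ∑ b, D a b w ^ 2 / ((j : ℝ) + 1) ^ 6 :=
          Finset.sum_le_sum_of_subset_of_nonneg (Finset.filter_subset _ _) fun w _ _ =>
            mul_nonneg (hpr0 w) (Finset.sum_nonneg fun _ _ => Finset.sum_nonneg fun _ _ => by
              positivity)
      _ = ∑ a, ∑ b, (∑ w, pr w * D a b w ^ 2) / ((j : ℝ) + 1) ^ 6 := by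
          simp only [Finset.mul_sum]
          rw [Finset.sum_comm]
          refine Finset.sum_congr rfl fun a _ => ?_
          rw [Finset.sum_comm]
          refine Finset.sum_congr rfl fun b _ => ?_
          rw [Finset.sum_div]
          refine Finset.sum_congr rfl fun w _ => ?_
          ring
      _ ≤ ∑ a : Fin m, ∑ b : Fin m, ((j : ℝ) + 1) ^ 5 / ((j : ℝ) + 1) ^ 6 := by
          gcongr with a _ b _; exact hED a b
      _ = (m : ℝ) ^ 2 / ((j : ℝ) + 1) := by
          simp only [Finset.sum_const, Finset.card_univ, Fintype.card_fin, nsmul_eq_mul]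
          field_simp
      _ ≤ 1 / 2 := by
          rw [div_le_iff₀ hj1]; linarith
  have hgood : 1 / 2 ≤ ∑ w ∈ G, pr w := by
    have h1 := Finset.sum_filter_add_sum_filter_not Finset.univ good pr
    have h2 := (sum_iid ν (fun _ => 0) hν1 (by simp) N).1
    have h3 : ∑ w, pr w = 1 := h2
    simp only [G]
    linarith
  set C0 := ∑ a, ∑ b, |Real.log (P a b)| with hC0
  have hDabs : ∀ w, good w → ∀ a b, |D a b w| ≤ ((j : ℝ) + 1) ^ 3 := by
    intro w hw a b
    exact abs_le_of_sq_le_sq (hw a b) (by positivity)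
  have hDS : ∀ w a b, ∑ i, S a b (w i) = D a b w + ((j : ℝ) + 1) ^ 3 * j * (p a * P a b) := by
    intro w a b
    simp only [D, g, Finset.sum_sub_distrib, Finset.sum_const, Finset.card_univ,
      Fintype.card_fin, nsmul_eq_mul, hNr]
    ring
  have hHeq : ∑ a, ∑ b, Real.log (P a b) * (p a * P a b) = - H2 p P := by
    simp only [H2, Finset.mul_sum, ← Finset.sum_neg_distrib, Real.negMulLog]
    refine Finset.sum_congr rfl fun a _ => Finset.sum_congr rfl fun b _ => ?_
    ring
  have hpru : ∀ w, good w → pr w ≤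
      Real.exp (-(((j : ℝ) + 1) ^ 3 * j * H2 p P) + C0 * ((j : ℝ) + 1) ^ 3) := by
    intro w hw
    calc pr w ≤ ∏ i, Real.exp (pathS (fun a b => Real.log (P a b)) (w i).1
            (List.ofFn (w i).2)) := by
          refine Finset.prod_le_prod (fun i _ => hν0 _) fun i _ => ?_
          exact le_trans (mul_le_of_le_one_left (pathW_nonneg hP _ _) (hp_le _))
            (pathW_le_exp hP _ _)
      _ = Real.exp (∑ i, ∑ a, ∑ b, Real.log (P a b) * S a b (w i)) := by
          rw [← Real.exp_sum]
          congr 1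
          exact Finset.sum_congr rfl fun i _ => pathS_eq_sum _ _ _
      _ = Real.exp (∑ a, ∑ b, Real.log (P a b) * ∑ i, S a b (w i)) := by
          congr 1
          rw [Finset.sum_comm]
          refine Finset.sum_congr rfl fun a _ => ?_
          rw [Finset.sum_comm]
          refine Finset.sum_congr rfl fun b _ => ?_
          rw [Finset.mul_sum]
      _ ≤ _ := by
          rw [Real.exp_le_exp]
          have e1 : ∑ a, ∑ b, Real.log (P a b) * ∑ i, S a b (w i)
              = ∑ a, ∑ b, Real.log (P a b) * D a b w
                + ((j : ℝ) + 1) ^ 3 * j * ∑ a, ∑ b, Real.log (P a b) * (p a * P a b) := by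
            simp only [hDS, Finset.mul_sum, ← Finset.sum_add_distrib]
            refine Finset.sum_congr rfl fun a _ => Finset.sum_congr rfl fun b _ => ?_
            ring
          have e2 : ∑ a, ∑ b, Real.log (P a b) * D a b w ≤ C0 * ((j : ℝ) + 1) ^ 3 := by
            rw [hC0, Finset.sum_mul]
            refine Finset.sum_le_sum fun a _ => ?_
            rw [Finset.sum_mul]
            refine Finset.sum_le_sum fun b _ => ?_
            calc _ ≤ |Real.log (P a b) * D a b w| := le_abs_self _
              _ = |Real.log (P a b)| * |D a b w| := abs_mul _ _
              _ ≤ _ := by gcongr; exact hDabs w hw a b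
          rw [e1, hHeq]
          linarith
  have hcard : 1 / 2 ≤ (G.card : ℝ) *
      Real.exp (-(((j : ℝ) + 1) ^ 3 * j * H2 p P) + C0 * ((j : ℝ) + 1) ^ 3) := by
    refine hgood.trans ?_
    rw [← nsmul_eq_mul]
    exact Finset.sum_le_card_nsmul _ _ _ fun w hw => hpru w (Finset.mem_filter.1 hw).2
  have hGpos : 0 < G.card := by
    rcases Nat.eq_zero_or_pos G.card with h | h
    · rw [h] at hcard; norm_num at hcard
    · exact h
  refine ⟨G.image sblk, ?_, ?_, ?_, ?_⟩
  · exact (Finset.card_pos.1 hGpos).image _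
  · intro w hw
    obtain ⟨v, _, rfl⟩ := Finset.mem_image.1 hw
    rw [sblk_length, hN]; ring
  · intro w hw a b
    obtain ⟨v, hv, rfl⟩ := Finset.mem_image.1 hw
    have hvg : good v := (Finset.mem_filter.1 hv).2
    have h1 := lS_flatten (indP_nonneg a b) (indP_le_one a b) (List.ofFn fun i => blk (v i))
    have h2 : ((List.ofFn fun i => blk (v i)).map (lS (indP a b))).sum = ∑ i, S a b (v i) := by
      rw [List.map_ofFn, List.sum_ofFn]
      rfl
    rw [h2, List.length_ofFn, hDS, hNr] at h1
    have h3 := hDabs v hvg a b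
    have h4 : ((j : ℝ) + 1) ^ 3 * (p a * P a b) ≤ ((j : ℝ) + 1) ^ 3 :=
      mul_le_of_le_one_right (by positivity) (hπ1 a b)
    have h5 : 0 ≤ ((j : ℝ) + 1) ^ 3 * (p a * P a b) := mul_nonneg (by positivity) (hπ0 a b)
    have h6 : ((j : ℝ) + 1) ^ 4 * (p a * P a b)
        = ((j : ℝ) + 1) ^ 3 * j * (p a * P a b) + ((j : ℝ) + 1) ^ 3 * (p a * P a b) := by ring
    rw [h6]
    simp only [sblk]
    rw [abs_le] at *
    constructor <;> linarith [h1.1, h1.2, h3.1, h3.2]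
  · rw [Finset.card_image_of_injective _ sblk_inj]
    have hGr : (0 : ℝ) < G.card := by exact_mod_cast hGpos
    have h1 := Real.log_le_log (by norm_num) hcard
    rw [Real.log_mul hGr.ne' (Real.exp_pos _).ne', Real.log_exp, one_div, Real.log_inv] at h1
    have h2 : Real.log 2 ≤ 1 := by linarith [Real.log_two_lt_d9]
    have h3 : (1 : ℝ) ≤ ((j : ℝ) + 1) ^ 3 := one_le_pow₀ (by linarith [Nat.cast_nonneg (α := ℝ) j])
    nlinarith [h1, h2, h3]

lemma exists_words (hm : 2 ≤ m) {p : Fin m → ℝ} {P : Fin m → Fin m → ℝ}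
    (hp : ∀ i, 0 ≤ p i) (hp1 : ∑ i, p i = 1)
    (hP : ∀ i j, 0 ≤ P i j) (hP1 : ∀ i, ∑ j, P i j = 1)
    (hst : ∀ j, ∑ i, p i * P i j = p j) :
    ∃ C : ℝ, 0 ≤ C ∧ ∃ W : ℕ → Finset (List (Fin m)), ∀ j : ℕ,
      (W j).Nonempty ∧ (∀ w ∈ W j, w.length = (j + 1) ^ 4) ∧
      (∀ w ∈ W j, ∀ a b, |lS (indP a b) w - ((j : ℝ) + 1) ^ 4 * (p a * P a b)|
        ≤ C * ((j : ℝ) + 1) ^ 3) ∧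
      ((j : ℝ) + 1) ^ 4 * H2 p P - C * ((j : ℝ) + 1) ^ 3 ≤ Real.log (W j).card := by
  have hH := H2_nonneg hp hP hP1
  set C0 := ∑ a, ∑ b, |Real.log (P a b)| with hC0
  have hC00 : 0 ≤ C0 := Finset.sum_nonneg fun _ _ => Finset.sum_nonneg fun _ _ => abs_nonneg _
  have hp_le : ∀ i, p i ≤ 1 := fun i => by
    rw [← hp1]; exact Finset.single_le_sum (fun k _ => hp k) (Finset.mem_univ i)
  have hP_le : ∀ i k, P i k ≤ 1 := fun i k => by
    rw [← hP1 i]; exact Finset.single_le_sum (fun k _ => hP i k) (Finset.mem_univ k)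
  set C := 3 + (H2 p P + C0 + 1) + 2 * (m : ℝ) ^ 2 * (1 + H2 p P) with hC
  have hq : 0 ≤ 2 * (m : ℝ) ^ 2 * (1 + H2 p P) := by positivity
  refine ⟨C, by rw [hC]; positivity, ?_⟩
  have : ∀ j : ℕ, ∃ W : Finset (List (Fin m)),
      W.Nonempty ∧ (∀ w ∈ W, w.length = (j + 1) ^ 4) ∧
      (∀ w ∈ W, ∀ a b, |lS (indP a b) w - ((j : ℝ) + 1) ^ 4 * (p a * P a b)|
        ≤ C * ((j : ℝ) + 1) ^ 3) ∧
      ((j : ℝ) + 1) ^ 4 * H2 p P - C * ((j : ℝ) + 1) ^ 3 ≤ Real.log W.card := by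
    intro j
    have hj3 : (0 : ℝ) < ((j : ℝ) + 1) ^ 3 := by positivity
    by_cases hj : 2 * (m : ℝ) ^ 2 ≤ j + 1
    · obtain ⟨W, h1, h2, h3, h4⟩ := good_words hp hp1 hP hP1 hst j hj
      refine ⟨W, h1, h2, fun w hw a b => (h3 w hw a b).trans ?_, le_trans ?_ h4⟩
      · apply mul_le_mul_of_nonneg_right _ hj3.le
        rw [hC]; linarith
      · apply sub_le_sub_left
        apply mul_le_mul_of_nonneg_right _ hj3.le
        rw [hC]; linarith
    · push Not at hj
      refine ⟨{List.replicate ((j + 1) ^ 4) ⟨0, by omega⟩}, by simp, by simp, ?_, ?_⟩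
      · intro w hw a b
        rw [Finset.mem_singleton] at hw
        have hl : (w.length : ℝ) = ((j : ℝ) + 1) ^ 4 := by rw [hw]; simp
        have h0 := lS_nonneg (indP_nonneg a b) w
        have h1 := lS_le (indP_le_one a b) w
        rw [hl] at h1
        have hπ0 : 0 ≤ p a * P a b := mul_nonneg (hp a) (hP a b)
        have hπ1 : p a * P a b ≤ 1 := mul_le_one₀ (hp_le a) (hP a b) (hP_le a b)
        have h2 : ((j : ℝ) + 1) ^ 4 * (p a * P a b) ≤ ((j : ℝ) + 1) ^ 4 :=
          mul_le_of_le_one_right (by positivity) hπ1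
        have h3 : 0 ≤ ((j : ℝ) + 1) ^ 4 * (p a * P a b) := by positivity
        have h4 : ((j : ℝ) + 1) ^ 4 ≤ C * ((j : ℝ) + 1) ^ 3 := by
          rw [pow_succ' _ 3]
          apply mul_le_mul_of_nonneg_right _ hj3.le
          rw [hC]; nlinarith
        rw [abs_le]; constructor <;> linarith
      · simp only [Finset.card_singleton, Nat.cast_one, Real.log_one]
        have h5 : ((j : ℝ) + 1) * H2 p P ≤ C := by
          rw [hC]
          nlinarith [mul_le_mul_of_nonneg_right hj.le hH]
        nlinarith [mul_le_mul_of_nonneg_right h5 hj3.le]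
  choose W hW using this
  exact ⟨W, hW⟩

end Words

section Concat

variable {m : ℕ}

/-- Concatenation of the first `K` words. -/
def flat (v : ℕ → List (Fin m)) : ℕ → List (Fin m)
  | 0 => []
  | K + 1 => flat v K ++ v K

/-- Total length of the first `K` blocks. -/
def TT (K : ℕ) : ℕ := ∑ k ∈ Finset.range K, (k + 1) ^ 4

/-- The infinite concatenation. -/
def seqOf (a0 : Fin m) (v : ℕ → List (Fin m)) : ℕ → Fin m := fun n => (flat v (n + 1)).getD n a0

lemma TT_succ (K : ℕ) : TT (K + 1) = TT K + (K + 1) ^ 4 := Finset.sum_range_succ _ _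

lemma le_TT (K : ℕ) : K ≤ TT K := by
  induction K with
  | zero => simp
  | succ K ih =>
    rw [TT_succ]
    have : 1 ≤ (K + 1) ^ 4 := Nat.one_le_pow _ _ (by omega)
    omega

lemma TT_mono : Monotone TT := monotone_nat_of_le_succ fun K => by rw [TT_succ]; omega

lemma exists_TT (n : ℕ) : ∃ K, TT K ≤ n ∧ n < TT (K + 1) := by
  induction n with
  | zero => exact ⟨0, by simp [TT]⟩
  | succ n ih =>
    obtain ⟨K, h1, h2⟩ := ih
    by_cases h : n + 1 < TT (K + 1)
    · exact ⟨K, by omega, h⟩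
    · refine ⟨K + 1, by omega, ?_⟩
      rw [TT_succ (K + 1)]
      have : 1 ≤ (K + 1 + 1) ^ 4 := Nat.one_le_pow _ _ (by omega)
      omega

lemma flat_length {v : ℕ → List (Fin m)} (hv : ∀ k, (v k).length = (k + 1) ^ 4) (K : ℕ) :
    (flat v K).length = TT K := by
  induction K with
  | zero => simp [flat, TT]
  | succ K ih => rw [flat, List.length_append, ih, hv, TT_succ]

lemma flat_prefix (v : ℕ → List (Fin m)) {K K' : ℕ} (h : K ≤ K') : flat v K <+: flat v K' := by
  induction K', h using Nat.le_induction with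
  | base => exact List.prefix_rfl
  | succ K' _ ih => exact ih.trans (List.prefix_append _ _)

lemma getD_prefix {l l' : List (Fin m)} (h : l <+: l') {n : ℕ} (hn : n < l.length) (a : Fin m) :
    l'.getD n a = l.getD n a := by
  obtain ⟨t, rfl⟩ := h
  rw [List.getD_append _ _ _ _ hn]

lemma seqOf_eq (a0 : Fin m) {v : ℕ → List (Fin m)} (hv : ∀ k, (v k).length = (k + 1) ^ 4)
    {K n : ℕ} (hn : n < TT K) : seqOf a0 v n = (flat v K).getD n a0 := by
  unfold seqOf
  have h1 : n < (flat v (n + 1)).length := by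
    rw [flat_length hv]; exact le_TT (n + 1)
  have h2 : n < (flat v K).length := by rwa [flat_length hv]
  rcases le_total K (n + 1) with h | h
  · exact getD_prefix (flat_prefix v h) h2 a0
  · exact (getD_prefix (flat_prefix v h) h1 a0).symm

lemma flat_eq_ofFn (a0 : Fin m) {v : ℕ → List (Fin m)} (hv : ∀ k, (v k).length = (k + 1) ^ 4)
    (K : ℕ) : flat v K = List.ofFn (fun i : Fin (TT K) => seqOf a0 v i) := by
  apply List.ext_getElem
  · simp [flat_length hv]
  · intro n h1 h2
    rw [List.getElem_ofFn]
    rw [flat_length hv] at h1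
    simp only
    rw [seqOf_eq a0 hv h1, List.getD_eq_getElem]

/-- Agreement of the first `TT K` coordinates forces agreement of the first `K` blocks. -/
lemma seqOf_inj (a0 : Fin m) {v w : ℕ → List (Fin m)} (hv : ∀ k, (v k).length = (k + 1) ^ 4)
    (hw : ∀ k, (w k).length = (k + 1) ^ 4) {K : ℕ}
    (h : ∀ n < TT K, seqOf a0 v n = seqOf a0 w n) : ∀ k < K, v k = w k := by
  have h1 : flat v K = flat w K := by
    rw [flat_eq_ofFn a0 hv, flat_eq_ofFn a0 hw]
    congr 1
    funext i
    exact h i i.2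
  clear h
  induction K with
  | zero => simp
  | succ K ih =>
    simp only [flat] at h1
    obtain ⟨e1, e2⟩ := List.append_inj h1 (by rw [flat_length hv, flat_length hw])
    intro k hk
    rcases Nat.lt_succ_iff_lt_or_eq.1 hk with h | rfl
    · exact ih e1 k h
    · exact e2

lemma lS_flat {f : Fin m → Fin m → ℝ} (h0 : ∀ a b, 0 ≤ f a b) (h1 : ∀ a b, f a b ≤ 1)
    (v : ℕ → List (Fin m)) (K : ℕ) :
    |lS f (flat v K) - ∑ k ∈ Finset.range K, lS f (v k)| ≤ K := by
  induction K with
  | zero => simp [flat, lS]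
  | succ K ih =>
    have h := lS_append h0 h1 (flat v K) (v K)
    rw [Finset.sum_range_succ, flat]
    push_cast
    rw [abs_le] at *
    constructor <;> linarith [h.1, h.2, ih.1, ih.2]

lemma lS_ofFn_seq {f : Fin m → Fin m → ℝ} (h0 : ∀ a b, 0 ≤ f a b) (h1 : ∀ a b, f a b ≤ 1)
    (x : ℕ → Fin m) (n : ℕ) :
    |lS f (List.ofFn fun i : Fin n => x i) - ∑ t ∈ Finset.range n, f (x t) (x (t + 1))| ≤ 1 := by
  cases n with
  | zero => simp [lS]
  | succ n =>
    rw [List.ofFn_succ, Finset.sum_range_succ]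
    simp only [lS, Fin.val_zero, Fin.val_succ]
    rw [pathS_seq, abs_le]
    constructor <;> linarith [h0 (x n) (x (n + 1)), h1 (x n) (x (n + 1))]

/-- Error term. -/
noncomputable def RR (C : ℝ) (K : ℕ) : ℝ :=
  (∑ k ∈ Finset.range K, (C * ((k : ℝ) + 1) ^ 3 + 1
    + 2 * (((k : ℝ) + 2) ^ 4 - ((k : ℝ) + 1) ^ 4))) + 3

lemma RR_eq (C : ℝ) (K : ℕ) :
    RR C K = (∑ k ∈ Finset.range K, C * ((k : ℝ) + 1) ^ 3) + K + 2 * ((K : ℝ) + 1) ^ 4 + 1 := by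
  induction K with
  | zero => simp [RR]; norm_num
  | succ K ih =>
    have : RR C (K + 1) = RR C K + (C * ((K : ℝ) + 1) ^ 3 + 1
      + 2 * (((K : ℝ) + 2) ^ 4 - ((K : ℝ) + 1) ^ 4)) := by
      simp only [RR, Finset.sum_range_succ]; ring
    rw [this, ih, Finset.sum_range_succ]
    push_cast; ring

lemma RR_small (C : ℝ) {ε : ℝ} (hε : 0 < ε) : ∀ᶠ K in atTop, RR C K ≤ ε * TT K := by
  have hT : ∀ K, (TT K : ℝ) = ∑ k ∈ Finset.range K, ((k : ℝ) + 1) ^ 4 := by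
    intro K; simp [TT]
  have htop : Tendsto (fun K => ∑ k ∈ Finset.range K, ((k : ℝ) + 1) ^ 4) atTop atTop := by
    simp only [← hT]
    exact tendsto_natCast_atTop_atTop.comp (tendsto_atTop_mono le_TT tendsto_id)
  have hx : Tendsto (fun k : ℕ => 1 / ((k : ℝ) + 1)) atTop (𝓝 0) :=
    tendsto_one_div_add_atTop_nhds_zero_nat
  have hd : (fun k : ℕ => (C * ((k : ℝ) + 1) ^ 3 + 1
      + 2 * (((k : ℝ) + 2) ^ 4 - ((k : ℝ) + 1) ^ 4))) =o[atTop]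
      (fun k : ℕ => ((k : ℝ) + 1) ^ 4) := by
    rw [Asymptotics.isLittleO_iff_tendsto (fun k h => by
      exfalso; have : (0 : ℝ) < ((k : ℝ) + 1) ^ 4 := by positivity
      exact this.ne' h)]
    have : ∀ k : ℕ, (C * ((k : ℝ) + 1) ^ 3 + 1
      + 2 * (((k : ℝ) + 2) ^ 4 - ((k : ℝ) + 1) ^ 4)) / ((k : ℝ) + 1) ^ 4
      = (C + 8) * (1 / ((k : ℝ) + 1)) + 12 * (1 / ((k : ℝ) + 1)) ^ 2
        + 8 * (1 / ((k : ℝ) + 1)) ^ 3 + 3 * (1 / ((k : ℝ) + 1)) ^ 4 := by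
      intro k
      have : (k : ℝ) + 1 ≠ 0 := by positivity
      field_simp; ring
    simp only [this]
    have h := (((hx.const_mul (C + 8)).add ((hx.pow 2).const_mul 12)).add
      ((hx.pow 3).const_mul 8)).add ((hx.pow 4).const_mul 3)
    simpa using h
  have h1 := hd.sum_range (fun k => by positivity) htop
  have h2 := h1.bound (half_pos hε)
  have h3 := htop.eventually_ge_atTop (6 / ε)
  filter_upwards [h2, h3] with K h2 h3
  rw [hT]
  have hpos : 0 ≤ ∑ k ∈ Finset.range K, ((k : ℝ) + 1) ^ 4 :=
    Finset.sum_nonneg fun _ _ => by positivity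
  rw [Real.norm_eq_abs, Real.norm_eq_abs, abs_of_nonneg hpos] at h2
  have h4 := (le_abs_self _).trans h2
  rw [div_le_iff₀ hε] at h3
  unfold RR
  linarith

lemma seq_bound (a0 : Fin m) {v : ℕ → List (Fin m)} (hv : ∀ k, (v k).length = (k + 1) ^ 4)
    {C π : ℝ} (hπ0 : 0 ≤ π) (hπ1 : π ≤ 1) (a b : Fin m)
    (hvS : ∀ k : ℕ, |lS (indP a b) (v k) - ((k : ℝ) + 1) ^ 4 * π| ≤ C * ((k : ℝ) + 1) ^ 3)
    {K n : ℕ} (h1 : TT K ≤ n) (h2 : n < TT (K + 1)) :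
    |∑ t ∈ Finset.range n, indP a b (seqOf a0 v (t + 1)) (seqOf a0 v (t + 2)) - n * π|
      ≤ RR C K := by
  set x := seqOf a0 v with hx
  set F : ℕ → ℝ := fun t => indP a b (x t) (x (t + 1)) with hF
  have hF0 : ∀ t, 0 ≤ F t := fun t => indP_nonneg _ _ _ _
  have hF1 : ∀ t, F t ≤ 1 := fun t => indP_le_one _ _ _ _
  have e0 : ∑ t ∈ Finset.range n, indP a b (x (t + 1)) (x (t + 2))
      = ∑ t ∈ Finset.range n, F t + F n - F 0 := by
    have e1 := Finset.sum_range_succ' F n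
    rw [Finset.sum_range_succ] at e1
    simp only [hF] at e1 ⊢
    linarith
  have e2 : ∑ t ∈ Finset.range n, F t
      = ∑ t ∈ Finset.range (TT K), F t + ∑ t ∈ Finset.Ico (TT K) n, F t :=
    (Finset.sum_range_add_sum_Ico _ h1).symm
  have e3 : 0 ≤ ∑ t ∈ Finset.Ico (TT K) n, F t := Finset.sum_nonneg fun t _ => hF0 t
  have e4 : ∑ t ∈ Finset.Ico (TT K) n, F t ≤ (n : ℝ) - TT K := by
    calc ∑ t ∈ Finset.Ico (TT K) n, F t ≤ ∑ t ∈ Finset.Ico (TT K) n, (1 : ℝ) :=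
          Finset.sum_le_sum fun t _ => hF1 t
      _ = _ := by simp [Nat.cast_sub h1]
  have e5 : (n : ℝ) - TT K ≤ ((K : ℝ) + 1) ^ 4 := by
    rw [TT_succ] at h2
    have : (n : ℝ) ≤ TT K + ((K : ℝ) + 1) ^ 4 := by exact_mod_cast h2.le
    linarith
  have e6 : (0 : ℝ) ≤ (n : ℝ) - TT K := by
    have : (TT K : ℝ) ≤ n := by exact_mod_cast h1
    linarith
  have e7 := lS_ofFn_seq (indP_nonneg a b) (indP_le_one a b) x (TT K)
  rw [hx, ← flat_eq_ofFn a0 hv, ← hx] at e7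
  have e8 := lS_flat (indP_nonneg a b) (indP_le_one a b) v K
  have e9 : |∑ k ∈ Finset.range K, lS (indP a b) (v k) - TT K * π|
      ≤ ∑ k ∈ Finset.range K, C * ((k : ℝ) + 1) ^ 3 := by
    have : (TT K : ℝ) * π = ∑ k ∈ Finset.range K, ((k : ℝ) + 1) ^ 4 * π := by
      simp [TT, Finset.sum_mul]
    rw [this, ← Finset.sum_sub_distrib]
    exact (Finset.abs_sum_le_sum_abs _ _).trans (Finset.sum_le_sum fun k _ => hvS k)
  have e10 : ((n : ℝ) - TT K) * π ≤ (n : ℝ) - TT K := mul_le_of_le_one_right e6 hπ1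
  have e11 : 0 ≤ ((n : ℝ) - TT K) * π := mul_nonneg e6 hπ0
  have e12 : (1 : ℝ) ≤ ((K : ℝ) + 1) ^ 4 := one_le_pow₀ (by linarith [Nat.cast_nonneg (α := ℝ) K])
  have e13 := hF0 n
  have e14 := hF1 n
  have e15 := hF0 0
  have e16 := hF1 0
  have e17 : ((n : ℝ) - TT K) * π = n * π - TT K * π := by ring
  rw [e0, e2, RR_eq]
  change |lS (indP a b) (flat v K) - ∑ t ∈ Finset.range (TT K), F t| ≤ 1 at e7
  rw [abs_le] at *
  constructor <;> linarith [e7.1, e7.2, e8.1, e8.2, e9.1, e9.2]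

lemma seq_tendsto (a0 : Fin m) {v : ℕ → List (Fin m)} (hv : ∀ k, (v k).length = (k + 1) ^ 4)
    {C π : ℝ} (hπ0 : 0 ≤ π) (hπ1 : π ≤ 1) (a b : Fin m)
    (hvS : ∀ k : ℕ, |lS (indP a b) (v k) - ((k : ℝ) + 1) ^ 4 * π| ≤ C * ((k : ℝ) + 1) ^ 3) :
    Tendsto (fun n : ℕ => (∑ t ∈ Finset.range n,
      indP a b (seqOf a0 v (t + 1)) (seqOf a0 v (t + 2))) / (n : ℝ)) atTop (𝓝 π) := by
  rw [Metric.tendsto_atTop]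
  intro ε hε
  obtain ⟨K0, hK0⟩ := eventually_atTop.1 (RR_small C (half_pos hε))
  refine ⟨TT K0 + 1, fun n hn => ?_⟩
  obtain ⟨K, h1, h2⟩ := exists_TT n
  have hK : K0 ≤ K := by
    by_contra h
    have := TT_mono (show K + 1 ≤ K0 by omega)
    omega
  have h3 := seq_bound a0 hv hπ0 hπ1 a b hvS h1 h2
  have h4 := hK0 K hK
  have hn0 : (0 : ℝ) < n := by exact_mod_cast (show 0 < n by omega)
  have h5 : (TT K : ℝ) ≤ n := by exact_mod_cast h1
  rw [Real.dist_eq]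
  have : (∑ t ∈ Finset.range n,
      indP a b (seqOf a0 v (t + 1)) (seqOf a0 v (t + 2))) / (n : ℝ) - π
      = (∑ t ∈ Finset.range n,
      indP a b (seqOf a0 v (t + 1)) (seqOf a0 v (t + 2)) - n * π) / n := by
    field_simp
  rw [this, abs_div, abs_of_pos hn0, div_lt_iff₀ hn0]
  nlinarith

end Concat

section Dyn

variable {m : ℕ}

lemma shift_iter (k : ℕ) (x : ℕ → Fin m) (n : ℕ) : ((shift m)^[k] x) n = x (n + k) := by
  induction k generalizing x with
  | zero => rfl
  | succ k ih =>
    rw [Function.iterate_succ_apply, ih]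
    simp only [shift]
    congr 1

/-- Empirical pair frequencies. -/
noncomputable def freq (x : ℕ → Fin m) (n : ℕ) : Fin m → Fin m → ℝ := fun i j =>
  (∑ t ∈ Finset.range n, indP i j (x (t + 1)) (x (t + 2))) / (n : ℝ)

/-- The function `A`. -/
noncomputable def Aval {r : ℕ} (φ : Fin r → Fin m → Fin m → ℝ) (π : Fin m → Fin m → ℝ) : ℝ :=
  ∏ k : Fin r, ∑ i : Fin m, ∑ j : Fin m, φ k i j * π i j

lemma continuous_Aval {r : ℕ} (φ : Fin r → Fin m → Fin m → ℝ) : Continuous (Aval φ) := by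
  unfold Aval
  fun_prop

lemma Vstat_eq {r : ℕ} (φ : Fin r → Fin m → Fin m → ℝ)
    {Φ : (Fin r → (ℕ → Fin m)) → ℝ}
    (hΦ : Φ = fun x => ∏ k : Fin r, φ k (x k 0) (x k 1)) (n : ℕ) (x : ℕ → Fin m) :
    Vstat (shift m) Φ n x = Aval φ (freq x n) := by
  classical
  have h1 : ∀ k, ∑ i : Fin m, ∑ j : Fin m, φ k i j * freq x n i j
      = (∑ t : Fin n, φ k (x ((t : ℕ) + 1)) (x ((t : ℕ) + 2))) / n := by
    intro k
    have h2 : ∀ t, φ k (x (t + 1)) (x (t + 2))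
        = ∑ i : Fin m, ∑ j : Fin m, φ k i j * indP i j (x (t + 1)) (x (t + 2)) :=
      fun t => (sum_indP _ _ _).symm
    have h3 := Fin.sum_univ_eq_sum_range (fun t : ℕ => φ k (x (t + 1)) (x (t + 2))) n
    rw [h3]
    simp only [h2]
    conv_rhs => rw [Finset.sum_comm, Finset.sum_div]
    refine Finset.sum_congr rfl fun i _ => ?_
    conv_rhs => rw [Finset.sum_comm, Finset.sum_div]
    refine Finset.sum_congr rfl fun j _ => ?_
    rw [freq, ← Finset.mul_sum, mul_div_assoc]
  unfold Vstat Aval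
  simp only [h1]
  rw [Finset.prod_div_distrib, Finset.prod_univ_sum, Finset.prod_const, Finset.card_univ,
    Fintype.card_fin, Fintype.piFinset_univ]
  congr 1
  refine Finset.sum_congr rfl fun i _ => ?_
  rw [hΦ]
  refine Finset.prod_congr rfl fun k _ => ?_
  simp only [shift_iter]
  congr 2 <;> ring

lemma bowenBall_one {n : ℕ} {x y : ℕ → Fin m} (h : y ∈ bowenBall (shift m) n 1 x) :
    ∀ j < n, x j = y j := by
  intro j hj
  have h1 := h j hj
  by_contra hne
  have hne' : (shift m)^[j] x ≠ (shift m)^[j] y := by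
    intro h2
    have := congrFun h2 0
    simp only [shift_iter, zero_add] at this
    exact hne this
  rw [PiNat.dist_eq_of_ne hne'] at h1
  have h3 : PiNat.firstDiff ((shift m)^[j] x) ((shift m)^[j] y) = 0 := by
    by_contra h0
    have := PiNat.apply_eq_of_lt_firstDiff (Nat.pos_of_ne_zero h0)
    simp only [shift_iter, zero_add] at this
    exact hne this
  rw [h3] at h1
  norm_num at h1

lemma mem_bowenBall {n L : ℕ} {ε : ℝ} (hL : (1 / 2 : ℝ) ^ L < ε) {x y : ℕ → Fin m}
    (h : ∀ t < n + L, x t = y t) : y ∈ bowenBall (shift m) n ε x := by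
  intro j hj
  refine lt_of_le_of_lt ?_ hL
  rw [← PiNat.mem_cylinder_iff_dist_le]
  intro i hi
  simp only [shift_iter]
  exact h _ (by omega)

theorem lower_bound (hm : 2 ≤ m) {r : ℕ} (φ : Fin r → Fin m → Fin m → ℝ)
    {Φ : (Fin r → (ℕ → Fin m)) → ℝ}
    (hΦ : Φ = fun x => ∏ k : Fin r, φ k (x k 0) (x k 1)) {α : ℝ}
    {p : Fin m → ℝ} {P : Fin m → Fin m → ℝ}
    (hp : ∀ i, 0 ≤ p i) (hp1 : ∑ i, p i = 1)
    (hP : ∀ i j, 0 ≤ P i j) (hP1 : ∀ i, ∑ j, P i j = 1)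
    (hst : ∀ j, ∑ i, p i * P i j = p j)
    (hA : Aval φ (fun i j => p i * P i j) = α) :
    ENNReal.ofReal (H2 p P) ≤ htop (shift m) (Eset (shift m) Φ α) := by
  classical
  obtain ⟨C, hC0, W, hW⟩ := exists_words hm hp hp1 hP hP1 hst
  have hp_le : ∀ i, p i ≤ 1 := fun i => by
    rw [← hp1]; exact Finset.single_le_sum (fun k _ => hp k) (Finset.mem_univ i)
  have hP_le : ∀ i k, P i k ≤ 1 := fun i k => by
    rw [← hP1 i]; exact Finset.single_le_sum (fun k _ => hP i k) (Finset.mem_univ k)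
  let a0 : Fin m := ⟨0, by omega⟩
  let F : (∀ k, W k) → (ℕ → Fin m) := fun u => seqOf a0 (fun k => (u k : List (Fin m)))
  have hlen : ∀ u : (∀ k, W k), ∀ k, ((u k : List (Fin m))).length = (k + 1) ^ 4 :=
    fun u k => (hW k).2.1 _ (u k).2
  have hF : ∀ u, F u ∈ Eset (shift m) Φ α := by
    intro u
    simp only [Eset, Set.mem_ofPred_eq, Vstat_eq φ hΦ]
    rw [← hA]
    refine ((continuous_Aval φ).tendsto _).comp ?_
    rw [tendsto_pi_nhds]; intro a
    rw [tendsto_pi_nhds]; intro b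
    exact seq_tendsto a0 (hlen u) (mul_nonneg (hp a) (hP a b))
      (mul_le_one₀ (hp_le a) (hP a b) (hP_le a b)) a b
      (fun k => (hW k).2.2.1 _ (u k).2 a b)
  refine le_trans ?_ (le_iSup₂_of_le (1 : ℝ) one_pos le_rfl)
  refine le_iInf₂ fun s hs => ?_
  by_contra hlt
  push Not at hlt
  have hsH : (s : ℝ) < H2 p P := by
    rw [← ENNReal.ofReal_coe_nnreal] at hlt
    exact (ENNReal.ofReal_lt_ofReal_iff'.1 hlt).1
  have hs0 : (0 : ℝ) ≤ s := s.2
  -- the measure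
  have : ∀ k, Nonempty (W k) := fun k => (hW k).1.to_subtype
  let _ : ∀ k, MeasurableSpace (W k) := fun _ => ⊤
  let ν : ∀ k, Measure (W k) := fun k => (PMF.uniformOfFintype (W k)).toMeasure
  have : ∀ k, IsProbabilityMeasure (ν k) := fun k => PMF.toMeasure.isProbabilityMeasure _
  let μ : Measure (∀ k, W k) := Measure.infinitePi ν
  have hε : 0 < (H2 p P - s) / (1 + s) := div_pos (by linarith) (by linarith)
  obtain ⟨K0, hK0⟩ := eventually_atTop.1 (RR_small C hε)
  have hmass : ∀ (x : ℕ → Fin m) (n : ℕ), TT K0 ≤ n →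
      μ (F ⁻¹' (bowenBall (shift m) n 1 x)) ≤ ENNReal.ofReal (Real.exp (-(s * (n : ℝ)))) := by
    intro x n hn
    rcases Set.eq_empty_or_nonempty (F ⁻¹' (bowenBall (shift m) n 1 x)) with he | ⟨v, hv⟩
    · rw [he]; simp
    obtain ⟨K, h1, h2⟩ := exists_TT n
    have hK : K0 ≤ K := by
      by_contra h
      have := TT_mono (show K + 1 ≤ K0 by omega)
      omega
    have hsub : F ⁻¹' (bowenBall (shift m) n 1 x) ⊆
        ((Finset.range K : Finset ℕ) : Set ℕ).pi (fun k => {v k}) := by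
      intro u hu k hk
      have hk' : k < K := by simpa using hk
      have e1 := bowenBall_one hu
      have e2 := bowenBall_one hv
      have := seqOf_inj a0 (hlen u) (hlen v) (K := K)
        (fun t ht => (e1 t (by omega)).symm.trans (e2 t (by omega))) k hk'
      exact Subtype.ext this
    refine (measure_mono hsub).trans ?_
    have hm1 : μ (((Finset.range K : Finset ℕ) : Set ℕ).pi (fun k => {v k}))
        = ∏ k ∈ Finset.range K, ν k {v k} :=
      Measure.infinitePi_pi ν (fun _ _ => trivial)
    have hm2 : ∀ k, ν k {v k} = ENNReal.ofReal (Real.exp (-Real.log (W k).card)) := by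
      intro k
      have hc : (0 : ℝ) < (W k).card := by exact_mod_cast (hW k).1.card_pos
      simp only [ν]
      rw [PMF.toMeasure_apply_singleton _ _ MeasurableSpace.measurableSet_top, PMF.uniformOfFintype_apply,
        Fintype.card_coe, Real.exp_neg, Real.exp_log hc, ENNReal.ofReal_inv_of_pos hc,
        ENNReal.ofReal_natCast]
    rw [hm1]
    simp only [hm2]
    rw [← ENNReal.ofReal_prod_of_nonneg (fun _ _ => (Real.exp_pos _).le), ← Real.exp_sum]
    apply ENNReal.ofReal_le_ofReal
    rw [Real.exp_le_exp, Finset.sum_neg_distrib, neg_le_neg_iff]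
    have e1 : (TT K : ℝ) * H2 p P - ∑ k ∈ Finset.range K, C * ((k : ℝ) + 1) ^ 3
        ≤ ∑ k ∈ Finset.range K, Real.log (W k).card := by
      have : (TT K : ℝ) * H2 p P = ∑ k ∈ Finset.range K, ((k : ℝ) + 1) ^ 4 * H2 p P := by
        simp [TT, Finset.sum_mul]
      rw [this, ← Finset.sum_sub_distrib]
      exact Finset.sum_le_sum fun k _ => (hW k).2.2.2
    have e2 := RR_eq C K
    have e3 := hK0 K hK
    have e4 : (n : ℝ) ≤ TT K + ((K : ℝ) + 1) ^ 4 := by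
      rw [TT_succ] at h2
      exact_mod_cast h2.le
    have e5 : (0 : ℝ) ≤ ((K : ℝ) + 1) ^ 4 := by positivity
    have e6 : (0 : ℝ) ≤ K := Nat.cast_nonneg K
    have e7 : (0 : ℝ) ≤ ∑ k ∈ Finset.range K, C * ((k : ℝ) + 1) ^ 3 :=
      Finset.sum_nonneg fun _ _ => by positivity
    have e8 : RR C K * (1 + s) ≤ (H2 p P - s) * TT K := by
      have h := mul_le_mul_of_nonneg_right e3 (show (0 : ℝ) ≤ 1 + s by linarith)
      have h' : (H2 p P - s) / (1 + s) * TT K * (1 + s) = (H2 p P - s) * TT K := by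
        field_simp
      linarith
    have e9 : (s : ℝ) * n ≤ s * (TT K + ((K : ℝ) + 1) ^ 4) := mul_le_mul_of_nonneg_left e4 hs0
    have e10 : (s : ℝ) * ((K : ℝ) + 1) ^ 4 ≤ s * RR C K :=
      mul_le_mul_of_nonneg_left (by linarith) hs0
    linarith
  have hge : (1 : ℝ≥0∞) ≤ bowenHn (shift m) (Eset (shift m) Φ α) s 1 (TT K0) := by
    refine le_iInf fun c => le_iInf fun hc => le_iInf fun hn => ?_
    calc (1 : ℝ≥0∞) = μ Set.univ := measure_univ.symm
      _ ≤ μ (⋃ i, F ⁻¹' (bowenBall (shift m) (c i).2 1 (c i).1)) := by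
          refine measure_mono fun u _ => ?_
          have := hc (hF u)
          simpa [Set.mem_iUnion] using this
      _ ≤ ∑' i, μ (F ⁻¹' (bowenBall (shift m) (c i).2 1 (c i).1)) := measure_iUnion_le _
      _ ≤ _ := ENNReal.tsum_le_tsum fun i => hmass _ _ (hn i)
  have : (1 : ℝ≥0∞) ≤ bowenH (shift m) (Eset (shift m) Φ α) s 1 :=
    hge.trans (le_iSup (fun n => bowenHn (shift m) (Eset (shift m) Φ α) s 1 n) (TT K0))
  rw [hs] at this
  simp at this

end Dyn

section Upper

variable {m : ℕ}

/-- Entropy of a pair distribution. -/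
noncomputable def Hent (π : Fin m → Fin m → ℝ) : ℝ :=
  ∑ i, ∑ j, Real.negMulLog (π i j) - ∑ i, Real.negMulLog (∑ j, π i j)

lemma continuous_Hent : Continuous (Hent (m := m)) := by
  unfold Hent
  have := Real.continuous_negMulLog
  fun_prop

lemma Hent_eq_H2 {p : Fin m → ℝ} {P : Fin m → Fin m → ℝ} (hP1 : ∀ i, ∑ j, P i j = 1) :
    Hent (fun i j => p i * P i j) = H2 p P := by
  unfold Hent H2
  rw [← Finset.sum_sub_distrib]
  refine Finset.sum_congr rfl fun i _ => ?_
  simp only [← Finset.mul_sum, hP1, mul_one, Real.negMulLog_mul, Finset.sum_add_distrib,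
    ← Finset.sum_mul]
  ring

/-- Pair type of the word `a :: w`. -/
noncomputable def ptype {n : ℕ} (a : Fin m) (w : Fin n → Fin m) : Fin m → Fin m → ℝ :=
  fun i j => (pathN i j a (List.ofFn w) : ℝ) / n

lemma fiber_count {n : ℕ} (hn : 0 < n) (a : Fin m) (h : ℝ) (s : Finset (Fin n → Fin m))
    (hs : ∀ w ∈ s, Hent (ptype a w) ≤ h)
    (hs2 : ∀ w ∈ s, ∀ w' ∈ s, ptype a w = ptype a w') :
    (s.card : ℝ) ≤ Real.exp (n * h) := by
  rcases s.eq_empty_or_nonempty with rfl | ⟨w0, hw0⟩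
  · simpa using (Real.exp_pos _).le
  have hnr : (0 : ℝ) < n := by exact_mod_cast hn
  set π := ptype a w0 with hπ
  have hπ0 : ∀ i j, 0 ≤ π i j := fun i j => by simp only [hπ, ptype]; positivity
  set ρ : Fin m → ℝ := fun i => ∑ j, π i j with hρ
  have hρ0 : ∀ i, 0 ≤ ρ i := fun i => Finset.sum_nonneg fun j _ => hπ0 i j
  have hπρ : ∀ i j, π i j ≤ ρ i := fun i j =>
    Finset.single_le_sum (fun j _ => hπ0 i j) (Finset.mem_univ j)
  let Q : Fin m → Fin m → ℝ := fun i j => π i j / ρ i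
  have hQ : ∀ i j, 0 ≤ Q i j := fun i j => div_nonneg (hπ0 i j) (hρ0 i)
  have hQ1 : ∀ i, ∑ j, Q i j ≤ 1 := fun i => by
    simp only [Q, ← Finset.sum_div]
    exact div_self_le_one _
  have hW : ∀ w ∈ s, Real.exp (-(n * h)) ≤ pathW Q a (List.ofFn w) := by
    intro w hw
    have hN : ∀ i j, (pathN i j a (List.ofFn w) : ℝ) = n * π i j := by
      intro i j
      have := congrFun (congrFun (hs2 w hw w0 hw0) i) j
      rw [hπ, ← this, ptype]
      field_simp
    rw [pathW_eq_exp]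
    · rw [Real.exp_le_exp, pathS_eq_sum]
      have h1 : ∑ i, ∑ j, Real.log (Q i j) * pathS (indP i j) a (List.ofFn w)
          = - (n * Hent π) := by
        have h2 : ∀ i j, Real.log (Q i j) * pathS (indP i j) a (List.ofFn w)
            = n * (π i j * Real.log (π i j) - π i j * Real.log (ρ i)) := by
          intro i j
          rw [← pathN_eq, hN]
          rcases (hπ0 i j).eq_or_lt with h0 | h0
          · rw [← h0]; simp
          · have : 0 < ρ i := h0.trans_le (hπρ i j)
            simp only [Q]
            rw [Real.log_div h0.ne' this.ne']; ring
        simp only [h2, ← Finset.mul_sum, Finset.sum_sub_distrib, ← Finset.sum_mul]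
        simp only [Hent, Real.negMulLog, neg_mul, Finset.sum_neg_distrib, hρ]
        ring
      rw [h1]
      have := hs w0 hw0
      have := mul_le_mul_of_nonneg_left this hnr.le
      linarith
    · intro i j hij
      have : (0 : ℝ) < π i j := by
        have h1 : (0 : ℝ) < pathN i j a (List.ofFn w) := by exact_mod_cast hij
        rw [hN] at h1
        exact pos_of_mul_pos_right h1 hnr.le
      exact div_pos this (this.trans_le (hπρ i j))
  have h1 : (s.card : ℝ) * Real.exp (-(n * h)) ≤ 1 := by
    rw [← nsmul_eq_mul]
    refine (Finset.card_nsmul_le_sum s _ _ hW).trans ?_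
    refine le_trans ?_ (sum_pathW_le hQ hQ1 n a)
    exact Finset.sum_le_sum_of_subset_of_nonneg (Finset.subset_univ _)
      fun w _ _ => pathW_nonneg hQ _ _
  rw [Real.exp_neg, ← div_eq_mul_inv, div_le_one (Real.exp_pos _)] at h1
  exact h1

open Classical in
lemma count_words {n : ℕ} (hn : 0 < n) (a : Fin m) (h : ℝ) :
    ((Finset.univ.filter fun w : Fin n → Fin m => Hent (ptype a w) ≤ h).card : ℝ)
      ≤ ((n : ℝ) + 1) ^ (m * m) * Real.exp (n * h) := by
  set s := Finset.univ.filter fun w : Fin n → Fin m => Hent (ptype a w) ≤ h with hs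
  let code : (Fin n → Fin m) → (Fin m → Fin m → Fin (n + 1)) := fun w i j =>
    ⟨pathN i j a (List.ofFn w), by
      have := pathN_le i j a (List.ofFn w)
      rw [List.length_ofFn] at this; omega⟩
  have h1 := Finset.card_eq_sum_card_fiberwise (f := code) (s := s) (t := Finset.univ)
    (fun _ _ => by simp)
  rw [h1]
  push_cast
  calc ∑ c, ((s.filter fun w => code w = c).card : ℝ)
      ≤ ∑ c : Fin m → Fin m → Fin (n + 1), Real.exp (n * h) := by
        refine Finset.sum_le_sum fun c _ => fiber_count hn a h _ ?_ ?_
        · intro w hw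
          exact (Finset.mem_filter.1 (Finset.mem_filter.1 hw).1).2
        · intro w hw w' hw'
          have e : code w = code w' :=
            (Finset.mem_filter.1 hw).2.trans (Finset.mem_filter.1 hw').2.symm
          funext i j
          have := congrArg Fin.val (congrFun (congrFun e i) j)
          simp only [code] at this
          simp only [ptype, this]
    _ = _ := by
        simp only [Finset.sum_const, Finset.card_univ, Fintype.card_fun, Fintype.card_fin,
          nsmul_eq_mul]
        push_cast
        rw [pow_mul]

lemma freq_eq_ptype (x : ℕ → Fin m) (n : ℕ) :
    freq x n = ptype (x 1) (fun i : Fin n => x (i + 2)) := by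
  funext i j
  simp only [freq, ptype, pathN_eq]
  congr 1
  exact (pathS_seq (indP i j) (fun t => x (t + 1)) n).symm

/-- The simplex of pair distributions. -/
def simp2 (m : ℕ) : Set (Fin m → Fin m → ℝ) :=
  Set.Icc 0 1 ∩ {π | ∑ i, ∑ j, π i j = 1}

lemma isCompact_simp2 : IsCompact (simp2 m) := by
  refine isCompact_Icc.inter_right (isClosed_eq ?_ continuous_const)
  fun_prop

lemma freq_mem (x : ℕ → Fin m) {n : ℕ} (hn : 0 < n) : freq x n ∈ simp2 m := by
  have hnr : (0 : ℝ) < n := by exact_mod_cast hn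
  rw [freq_eq_ptype]
  refine ⟨⟨fun i j => ?_, fun i j => ?_⟩, ?_⟩
  · simp only [ptype, Pi.zero_apply]; positivity
  · simp only [ptype, Pi.one_apply]
    rw [div_le_one hnr]
    have := pathN_le i j (x 1) (List.ofFn fun i : Fin n => x (i + 2))
    rw [List.length_ofFn] at this
    exact_mod_cast this
  · change ∑ i, ∑ j, ptype _ _ i j = 1
    simp only [ptype, pathN_eq, ← Finset.sum_div, pathS_one, List.length_ofFn]
    exact div_self hnr.ne'

/-- Defect from being a stationary pair distribution with `A = α`. -/
noncomputable def defect {r : ℕ} (φ : Fin r → Fin m → Fin m → ℝ) (α : ℝ)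
    (π : Fin m → Fin m → ℝ) : ℝ :=
  |Aval φ π - α| + ∑ j, |∑ i, π i j - ∑ i, π j i|

lemma continuous_defect {r : ℕ} (φ : Fin r → Fin m → Fin m → ℝ) (α : ℝ) :
    Continuous (defect φ α) := by
  unfold defect
  have := continuous_Aval φ
  fun_prop

lemma defect_eq_zero {r : ℕ} {φ : Fin r → Fin m → Fin m → ℝ} {α : ℝ}
    {π : Fin m → Fin m → ℝ} : defect φ α π = 0 ↔
      Aval φ π = α ∧ ∀ j, ∑ i, π i j = ∑ i, π j i := by
  unfold defect
  rw [add_eq_zero_iff_of_nonneg (abs_nonneg _) (Finset.sum_nonneg fun _ _ => abs_nonneg _),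
    abs_eq_zero, sub_eq_zero, Finset.sum_eq_zero_iff_of_nonneg (fun _ _ => abs_nonneg _)]
  simp only [Finset.mem_univ, forall_true_left, abs_eq_zero, sub_eq_zero]

lemma defect_nonneg {r : ℕ} (φ : Fin r → Fin m → Fin m → ℝ) (α : ℝ)
    (π : Fin m → Fin m → ℝ) : 0 ≤ defect φ α π :=
  add_nonneg (abs_nonneg _) (Finset.sum_nonneg fun _ _ => abs_nonneg _)

lemma defect_tendsto {r : ℕ} (φ : Fin r → Fin m → Fin m → ℝ)
    {Φ : (Fin r → (ℕ → Fin m)) → ℝ}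
    (hΦ : Φ = fun x => ∏ k : Fin r, φ k (x k 0) (x k 1)) {α : ℝ} {x : ℕ → Fin m}
    (hx : x ∈ Eset (shift m) Φ α) :
    Tendsto (fun n => defect φ α (freq x n)) atTop (𝓝 0) := by
  have h1 : Tendsto (fun n => Aval φ (freq x n)) atTop (𝓝 α) := by
    have h : Tendsto (fun n => Vstat (shift m) Φ n x) atTop (𝓝 α) := hx
    simpa only [Vstat_eq φ hΦ] using h
  have h2 : Tendsto (fun n => |Aval φ (freq x n) - α|) atTop (𝓝 0) := by
    have := (h1.sub_const α).abs
    simpa using this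
  have h3 : ∀ j, Tendsto (fun n => |∑ i, freq x n i j - ∑ i, freq x n j i|) atTop (𝓝 0) := by
    intro j
    refine squeeze_zero (fun _ => abs_nonneg _) (fun n => ?_)
      (tendsto_const_div_atTop_nhds_zero_nat (1 : ℝ))
    let F : ℕ → ℝ := fun t => if x (t + 1) = j then 1 else 0
    have e1 : ∑ i, freq x n i j = (∑ t ∈ Finset.range n, F (t + 1)) / n := by
      simp only [freq, ← Finset.sum_div]
      rw [Finset.sum_comm]
      congr 1
      refine Finset.sum_congr rfl fun t _ => ?_
      simp only [indP, F]
      by_cases h : x (t + 2) = j <;> simp [h]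
    have e2 : ∑ i, freq x n j i = (∑ t ∈ Finset.range n, F t) / n := by
      simp only [freq, ← Finset.sum_div]
      rw [Finset.sum_comm]
      congr 1
      refine Finset.sum_congr rfl fun t _ => ?_
      simp only [indP, F]
      by_cases h : x (t + 1) = j <;> simp [h]
    have e3 : ∑ t ∈ Finset.range n, F (t + 1) - ∑ t ∈ Finset.range n, F t = F n - F 0 := by
      rw [← Finset.sum_sub_distrib, Finset.sum_range_sub]
    rw [e1, e2, ← sub_div, e3, abs_div, abs_of_nonneg (Nat.cast_nonneg (α := ℝ) n)]
    apply div_le_div_of_nonneg_right _ (Nat.cast_nonneg n)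
    simp only [F]
    split_ifs <;> norm_num
  have h4 := h2.add (tendsto_finsetSum Finset.univ fun j _ => h3 j)
  simpa [defect] using h4

lemma exists_limit {r : ℕ} (φ : Fin r → Fin m → Fin m → ℝ)
    {Φ : (Fin r → (ℕ → Fin m)) → ℝ}
    (hΦ : Φ = fun x => ∏ k : Fin r, φ k (x k 0) (x k 1)) {α : ℝ} {x : ℕ → Fin m}
    (hx : x ∈ Eset (shift m) Φ α) : ∃ π ∈ simp2 m, defect φ α π = 0 := by
  obtain ⟨π, hπ, ψ, hψ, hlim⟩ := isCompact_simp2.tendsto_subseq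
    (x := fun n => freq x (n + 1)) (fun n => freq_mem x (Nat.succ_pos n))
  refine ⟨π, hπ, ?_⟩
  have h1 := ((continuous_defect φ α).tendsto π).comp hlim
  have h2 := (defect_tendsto φ hΦ hx).comp ((tendsto_add_atTop_nat 1).comp hψ.tendsto_atTop)
  exact tendsto_nhds_unique h1 h2

lemma uniform_defect {r : ℕ} (φ : Fin r → Fin m → Fin m → ℝ) {α h h' : ℝ} (hh : h < h')
    (hmax : ∀ π ∈ simp2 m, defect φ α π = 0 → Hent π ≤ h) :
    ∃ η > 0, ∀ π ∈ simp2 m, defect φ α π < η → Hent π < h' := by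
  have hc : IsCompact (simp2 m ∩ {π | h' ≤ Hent π}) :=
    isCompact_simp2.inter_right (isClosed_le continuous_const continuous_Hent)
  rcases Set.eq_empty_or_nonempty (simp2 m ∩ {π | h' ≤ Hent π}) with he | hne
  · refine ⟨1, one_pos, fun π hπ _ => ?_⟩
    by_contra hcon
    have : π ∈ simp2 m ∩ {π | h' ≤ Hent π} := ⟨hπ, not_lt.1 hcon⟩
    rw [he] at this
    exact this
  · obtain ⟨π0, hπ0, hmin⟩ := hc.exists_isMinOn hne (continuous_defect φ α).continuousOn
    refine ⟨defect φ α π0, ?_, fun π hπ hlt => ?_⟩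
    · refine lt_of_le_of_ne (defect_nonneg _ _ _) fun h0 => ?_
      have h1 := hmax π0 hπ0.1 h0.symm
      have h2 : h' ≤ Hent π0 := hπ0.2
      linarith
    · by_contra hcon
      have h1 : π ∈ simp2 m ∩ {π | h' ≤ Hent π} := ⟨hπ, not_lt.1 hcon⟩
      have h2 : defect φ α π0 ≤ defect φ α π := hmin h1
      linarith

end Upper

section Upper

variable {m : ℕ}

lemma bowenHn_le {X : Type*} [MetricSpace X] {ι : Type*} [Countable ι] [Infinite ι]
    (T : X → X) (Z : Set X) (s ε : ℝ) (n : ℕ) (c : ι → X × ℕ)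
    (hc : ∀ x ∈ Z, ∃ i, x ∈ bowenBall T (c i).2 ε (c i).1) (hn : ∀ i, n ≤ (c i).2) :
    bowenHn T Z s ε n ≤ ∑' i, ENNReal.ofReal (Real.exp (-(s * ((c i).2 : ℝ)))) := by
  obtain ⟨hd⟩ := nonempty_denumerable ι
  let e : ι ≃ ℕ := Denumerable.eqv ι
  rw [← e.symm.tsum_eq]
  unfold bowenHn
  refine iInf_le_of_le (fun k => c (e.symm k)) (iInf_le_of_le ?_ (iInf_le_of_le ?_ le_rfl))
  · intro x hx
    obtain ⟨i, hi⟩ := hc x hx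
    refine Set.mem_iUnion.2 ⟨e i, ?_⟩
    simpa using hi
  · intro i; exact hn _

/-- Index set of low-entropy words. -/
abbrev LowW (m : ℕ) (h : ℝ) (n : ℕ) : Type :=
  Option (Fin m × (Σ a : Fin m, {w : Fin n → Fin m // Hent (ptype a w) ≤ h}))

noncomputable instance instFintypeLowW (h : ℝ) (n : ℕ) : Fintype (LowW m h n) :=
  Fintype.ofFinite _

lemma card_LowW (h : ℝ) {n : ℕ} (hn : 0 < n) :
    (Fintype.card (LowW m h n) : ℝ)
      ≤ 1 + m * (m * (((n : ℝ) + 1) ^ (m * m) * Real.exp (n * h))) := by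
  classical
  have h1 : Fintype.card (LowW m h n) = m * (∑ a : Fin m,
      (Finset.univ.filter fun w : Fin n → Fin m => Hent (ptype a w) ≤ h).card) + 1 := by
    rw [← Nat.card_eq_fintype_card, Finite.card_option, Nat.card_prod, Nat.card_sigma,
      Nat.card_fin]
    simp only [Nat.card_eq_fintype_card, Fintype.card_subtype]
  rw [h1]
  push_cast
  rw [add_comm]
  gcongr
  calc _ ≤ ∑ a : Fin m, (((n : ℝ) + 1) ^ (m * m) * Real.exp (n * h)) := by
        refine Finset.sum_le_sum fun a _ => ?_
        convert count_words hn a h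
    _ = _ := by simp

/-- Center of a Bowen ball for a low-entropy word. -/
def lowPt (a0 : Fin m) {h : ℝ} {n : ℕ} : LowW m h n → (ℕ → Fin m)
  | none => fun _ => a0
  | some b => fun t => if t = 0 then b.1 else if t = 1 then b.2.1 else
      if ht : t - 2 < n then b.2.2.1 ⟨t - 2, ht⟩ else a0

lemma lowPt_some (a0 : Fin m) {h : ℝ} {n : ℕ} (x : ℕ → Fin m)
    (hx : Hent (freq x n) ≤ h) : ∃ b : LowW m h n, ∀ t < n + 2, lowPt a0 b t = x t := by
  rw [freq_eq_ptype] at hx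
  refine ⟨some ⟨x 0, ⟨x 1, ⟨_, hx⟩⟩⟩, fun t ht => ?_⟩
  rcases t with _ | _ | t
  · simp [lowPt]
  · simp [lowPt]
  · have : t < n := by omega
    simp [lowPt, this]

lemma summable_cost (L : ℕ) {s h : ℝ} (hs : 0 < s) (hh : h < s) :
    Summable fun M : ℕ => (1 + (m : ℝ) * (m * ((((M + L : ℕ) : ℝ) + 1) ^ (m * m)
      * Real.exp (((M + L : ℕ) : ℝ) * h)))) * Real.exp (-(s * (M : ℝ))) := by
  have h1 : Summable fun M : ℕ => (Real.exp (-s)) ^ M :=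
    summable_geometric_of_lt_one (Real.exp_pos _).le (by simpa using hs)
  have h2 : Summable fun q : ℕ => (q : ℝ) ^ (m * m) * (Real.exp (h - s)) ^ q := by
    refine summable_pow_mul_geometric_of_norm_lt_one _ ?_
    rw [Real.norm_eq_abs, abs_of_pos (Real.exp_pos _)]
    simpa using hh
  have h3 := ((summable_nat_add_iff (L + 1)).2 h2).mul_left
    ((m : ℝ) * m * (Real.exp (s * L) * Real.exp (s - h)))
  refine (h1.add h3).congr fun M => ?_
  have e1 : Real.exp (-(s * (M : ℝ))) = Real.exp (-s) ^ M := by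
    rw [← Real.exp_nat_mul]; congr 1; ring
  have e2 : Real.exp (((M + L : ℕ) : ℝ) * h) * Real.exp (-(s * (M : ℝ)))
      = Real.exp (s * L) * Real.exp (s - h) * Real.exp (h - s) ^ (M + (L + 1)) := by
    rw [← Real.exp_nat_mul, ← Real.exp_add, ← Real.exp_add, ← Real.exp_add]
    congr 1; push_cast; ring
  have e3 : ((M + (L + 1) : ℕ) : ℝ) = ((M + L : ℕ) : ℝ) + 1 := by push_cast; ring
  rw [e3]
  calc _ = Real.exp (-s) ^ M + (m : ℝ) * m * (((M + L : ℕ) : ℝ) + 1) ^ (m * m) *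
        (Real.exp (((M + L : ℕ) : ℝ) * h) * Real.exp (-(s * (M : ℝ)))) := by
          rw [e2]; ring
    _ = _ := by rw [← e1]; ring

theorem bowenH_zero (a0 : Fin m) {r : ℕ} (φ : Fin r → Fin m → Fin m → ℝ)
    {Φ : (Fin r → (ℕ → Fin m)) → ℝ}
    (hΦ : Φ = fun x => ∏ k : Fin r, φ k (x k 0) (x k 1)) {α h s ε : ℝ} (hh0 : 0 ≤ h)
    (hmax : ∀ π ∈ simp2 m, defect φ α π = 0 → Hent π ≤ h) (hs : h < s) (hε : 0 < ε) :
    bowenH (shift m) (Eset (shift m) Φ α) s ε = 0 := by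
  obtain ⟨h', hh', hs'⟩ := exists_between hs
  obtain ⟨η, hη, hun⟩ := uniform_defect φ hh' hmax
  obtain ⟨L0, hL0⟩ := exists_pow_lt_of_lt_one hε (by norm_num : (1 / 2 : ℝ) < 1)
  obtain ⟨L, hLpos, hL⟩ : ∃ L : ℕ, 0 < L ∧ (1 / 2 : ℝ) ^ L < ε :=
    ⟨L0 + 1, Nat.succ_pos _, lt_of_le_of_lt
      (pow_le_pow_of_le_one (by norm_num) (by norm_num) (Nat.le_succ _)) hL0⟩
  have hsum := summable_cost (m := m) L (lt_of_le_of_lt hh0 hs) hs'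
  set A : ℕ → ℝ := fun M : ℕ => (1 + (m : ℝ) * (m * ((((M + L : ℕ) : ℝ) + 1) ^ (m * m)
      * Real.exp (((M + L : ℕ) : ℝ) * h')))) * Real.exp (-(s * (M : ℝ))) with hA
  have hA0 : ∀ M, 0 ≤ A M := fun M => by positivity
  unfold bowenH
  rw [ENNReal.iSup_eq_zero]
  intro n0
  have key : ∀ N ≥ n0, bowenHn (shift m) (Eset (shift m) Φ α) s ε n0
      ≤ ENNReal.ofReal (∑' k, A (k + N)) := by
    intro N hN
    let ι := Σ k : ℕ, LowW m h' (k + N + L)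
    have : Infinite ι := Infinite.of_injective (fun k : ℕ => (⟨k, none⟩ : ι))
      (fun a b hab => congrArg Sigma.fst hab)
    refine (bowenHn_le (ι := ι) _ _ s ε n0 (fun i => (lowPt a0 i.2, i.1 + N)) ?_ ?_).trans ?_
    · intro x hx
      have h1 := (defect_tendsto φ hΦ hx).eventually (gt_mem_nhds hη)
      obtain ⟨K, hK⟩ := eventually_atTop.1 h1
      have h2 := hun _ (freq_mem x (by omega : 0 < K + N + L)) (hK _ (by omega))
      obtain ⟨b, hb⟩ := lowPt_some a0 x h2.le
      exact ⟨⟨K, b⟩, mem_bowenBall hL fun t ht => hb t (by dsimp only at ht; omega)⟩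
    · intro i
      exact hN.trans (Nat.le_add_left _ _)
    · rw [ENNReal.tsum_sigma']
      rw [ENNReal.ofReal_tsum_of_nonneg (fun k => hA0 _) ((summable_nat_add_iff N).2 hsum)]
      refine ENNReal.tsum_le_tsum fun k => ?_
      simp only
      rw [tsum_fintype, Finset.sum_const, Finset.card_univ, nsmul_eq_mul,
        ← ENNReal.ofReal_natCast, ← ENNReal.ofReal_mul (by positivity)]
      apply ENNReal.ofReal_le_ofReal
      simp only [hA]
      gcongr
      exact card_LowW h' (by omega)
  have hlim : Tendsto (fun N => ENNReal.ofReal (∑' k, A (k + N))) atTop (𝓝 0) := by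
    have := ENNReal.tendsto_ofReal (tendsto_sum_nat_add A)
    simpa using this
  refine le_antisymm (ge_of_tendsto hlim ?_) zero_le
  exact eventually_atTop.2 ⟨n0, key⟩

theorem upper_bound (a0 : Fin m) {r : ℕ} (φ : Fin r → Fin m → Fin m → ℝ)
    {Φ : (Fin r → (ℕ → Fin m)) → ℝ}
    (hΦ : Φ = fun x => ∏ k : Fin r, φ k (x k 0) (x k 1)) {α h : ℝ} (hh0 : 0 ≤ h)
    (hmax : ∀ π ∈ simp2 m, defect φ α π = 0 → Hent π ≤ h) :
    htop (shift m) (Eset (shift m) Φ α) ≤ ENNReal.ofReal h := by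
  refine iSup₂_le fun ε hε => ?_
  by_contra hcon
  obtain ⟨s, hs1, hs2⟩ := ENNReal.lt_iff_exists_nnreal_btwn.1 (not_le.1 hcon)
  have hs : h < s := by
    rw [← ENNReal.ofReal_coe_nnreal] at hs1
    exact (ENNReal.ofReal_lt_ofReal_iff_of_nonneg hh0).1 hs1
  have h1 := bowenH_zero a0 φ hΦ hh0 hmax hs hε
  exact absurd (iInf₂_le (f := fun (s : ℝ≥0) (_ : bowenH (shift m) (Eset (shift m) Φ α) s ε = 0) => (s : ℝ≥0∞)) s h1) (not_le.2 hs2)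

theorem exists_max (hm : 2 ≤ m) {r : ℕ} (φ : Fin r → Fin m → Fin m → ℝ)
    {Φ : (Fin r → (ℕ → Fin m)) → ℝ}
    (hΦ : Φ = fun x => ∏ k : Fin r, φ k (x k 0) (x k 1)) {α : ℝ}
    (hne : (Eset (shift m) Φ α).Nonempty) :
    ∃ (p : Fin m → ℝ) (P : Fin m → Fin m → ℝ),
      (∀ i, 0 ≤ p i) ∧ ∑ i, p i = 1 ∧ (∀ i j, 0 ≤ P i j) ∧ (∀ i, ∑ j, P i j = 1) ∧
      (∀ j, ∑ i, p i * P i j = p j) ∧ Aval φ (fun i j => p i * P i j) = α ∧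
      ∀ π ∈ simp2 m, defect φ α π = 0 → Hent π ≤ H2 p P := by
  obtain ⟨x, hx⟩ := hne
  obtain ⟨π0, hπ0, hd0⟩ := exists_limit φ hΦ hx
  have hc : IsCompact (simp2 m ∩ {π | defect φ α π = 0}) :=
    isCompact_simp2.inter_right (isClosed_eq (continuous_defect φ α) continuous_const)
  obtain ⟨π, ⟨hπ, hd⟩, hmx⟩ := hc.exists_isMaxOn ⟨π0, hπ0, hd0⟩ continuous_Hent.continuousOn
  have hd' : defect φ α π = 0 := hd
  obtain ⟨hA, hst⟩ := defect_eq_zero.1 hd'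
  have hm0 : (m : ℝ) ≠ 0 := by
    have : 0 < m := by omega
    positivity
  have hpos : ∀ i j, 0 ≤ π i j := fun i j => hπ.1.1 i j
  have hp0 : ∀ i, 0 ≤ ∑ j, π i j := fun i => Finset.sum_nonneg fun j _ => hpos i j
  let P : Fin m → Fin m → ℝ := fun i j =>
    if ∑ j, π i j = 0 then 1 / (m : ℝ) else π i j / ∑ j, π i j
  have hmul : ∀ i j, (∑ j, π i j) * P i j = π i j := by
    intro i j
    by_cases h : ∑ j, π i j = 0
    · have := (Finset.sum_eq_zero_iff_of_nonneg (fun j _ => hpos i j)).1 h j (Finset.mem_univ j)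
      rw [h, this, zero_mul]
    · simp only [P, if_neg h]
      field_simp
  have hP1 : ∀ i, ∑ j, P i j = 1 := by
    intro i
    by_cases h : ∑ j, π i j = 0
    · simp [P, if_pos h, hm0]
    · simp only [P, if_neg h]
      rw [← Finset.sum_div, div_self h]
  have hfun : (fun i j => (∑ j, π i j) * P i j) = π := by
    funext i j; exact hmul i j
  refine ⟨fun i => ∑ j, π i j, P, hp0, hπ.2, ?_, hP1, ?_, ?_, ?_⟩
  · intro i j
    simp only [P]
    split_ifs
    · positivity
    · exact div_nonneg (hpos i j) (hp0 i)
  · intro j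
    simp only [hmul]
    exact hst j
  · simp only [hfun]; exact hA
  · intro π' hπ' hd'
    rw [← Hent_eq_H2 hP1, hfun]
    exact hmx ⟨hπ', hd'⟩

lemma pair_mem {r : ℕ} {φ : Fin r → Fin m → Fin m → ℝ} {α : ℝ}
    {p : Fin m → ℝ} {P : Fin m → Fin m → ℝ}
    (hp : ∀ i, 0 ≤ p i) (hp1 : ∑ i, p i = 1)
    (hP : ∀ i j, 0 ≤ P i j) (hP1 : ∀ i, ∑ j, P i j = 1)
    (hst : ∀ j, ∑ i, p i * P i j = p j)
    (hA : Aval φ (fun i j => p i * P i j) = α) :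
    (fun i j => p i * P i j) ∈ simp2 m ∧ defect φ α (fun i j => p i * P i j) = 0 := by
  have hp_le : ∀ i, p i ≤ 1 := fun i => by
    rw [← hp1]; exact Finset.single_le_sum (fun k _ => hp k) (Finset.mem_univ i)
  have hP_le : ∀ i k, P i k ≤ 1 := fun i k => by
    rw [← hP1 i]; exact Finset.single_le_sum (fun k _ => hP i k) (Finset.mem_univ k)
  refine ⟨⟨⟨fun i j => mul_nonneg (hp i) (hP i j), fun i j => ?_⟩, ?_⟩, ?_⟩
  · exact mul_le_one₀ (hp_le i) (hP i j) (hP_le i j)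
  · change ∑ i, ∑ j, p i * P i j = 1
    simp only [← Finset.mul_sum, hP1, mul_one, hp1]
  · refine defect_eq_zero.2 ⟨hA, fun j => ?_⟩
    rw [hst, ← Finset.mul_sum, hP1, mul_one]

lemma integral_two_coord {p : Fin m → ℝ} {P : Fin m → Fin m → ℝ}
    (hp : ∀ i, 0 ≤ p i) (hP : ∀ i j, 0 ≤ P i j)
    (μ : Measure (ℕ → Fin m)) (hμ1 : IsProbabilityMeasure μ)
    (hμ : ∀ (n : ℕ) (w : Fin (n + 1) → Fin m),
          μ {x : ℕ → Fin m | ∀ i : Fin (n + 1), x (i : ℕ) = w i} =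
            ENNReal.ofReal (p (w 0) * ∏ i : Fin n, P (w i.castSucc) (w i.succ)))
    (f : Fin m → Fin m → ℝ) :
    ∫ x, f (x 0) (x 1) ∂μ = ∑ i, ∑ j, f i j * (p i * P i j) := by
  classical
  have hset : ∀ i j, MeasurableSet {x : ℕ → Fin m | x 0 = i ∧ x 1 = j} := by
    intro i j
    have h1 : MeasurableSet ((fun x : ℕ → Fin m => x 0) ⁻¹' {i}) :=
      measurable_pi_apply 0 (MeasurableSet.singleton i)
    have h2 : MeasurableSet ((fun x : ℕ → Fin m => x 1) ⁻¹' {j}) :=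
      measurable_pi_apply 1 (MeasurableSet.singleton j)
    exact h1.inter h2
  have hmeas : ∀ i j, μ.real {x : ℕ → Fin m | x 0 = i ∧ x 1 = j} = p i * P i j := by
    intro i j
    have h := hμ 1 ![i, j]
    have he : {x : ℕ → Fin m | ∀ k : Fin (1 + 1), x (k : ℕ) = (![i, j] : Fin 2 → Fin m) k}
        = {x : ℕ → Fin m | x 0 = i ∧ x 1 = j} := by
      ext x
      simp [Fin.forall_fin_two]
    rw [he] at h
    rw [Measure.real, h]
    simp
    exact mul_nonneg (hp i) (hP i j)
  have hf : ∀ x : ℕ → Fin m, f (x 0) (x 1)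
      = ∑ i, ∑ j, Set.indicator {x : ℕ → Fin m | x 0 = i ∧ x 1 = j} (fun _ => f i j) x := by
    intro x
    rw [Finset.sum_eq_single (x 0), Finset.sum_eq_single (x 1)]
    · simp [Set.indicator]
    · intro j _ hj
      simp [Set.indicator, Ne.symm hj]
    · simp
    · intro i _ hi
      simp [Set.indicator, Ne.symm hi]
    · simp
  have hint : ∀ i j, Integrable
      (Set.indicator {x : ℕ → Fin m | x 0 = i ∧ x 1 = j} (fun _ => f i j)) μ :=
    fun i j => (integrable_const _).indicator (hset i j)
  simp only [hf]
  rw [integral_finsetSum _ fun i _ => integrable_finsetSum _ fun j _ => hint i j]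
  refine Finset.sum_congr rfl fun i _ => ?_
  rw [integral_finsetSum _ fun j _ => hint i j]
  refine Finset.sum_congr rfl fun j _ => ?_
  rw [integral_indicator_const _ (hset i j), hmeas, smul_eq_mul, mul_comm]

end Upper

/-- (Theorem 5.4) On the full shift `(Σ_m, σ)`, for a kernel
`Φ(x⁽¹⁾, …, x⁽ʳ⁾) = φ_1(x⁽¹⁾_1, x⁽¹⁾_2) ⋯ φ_r(x⁽ʳ⁾_1, x⁽ʳ⁾_2)` depending on the first two
coordinates of each variable: for any probability vector `p` and stochastic matrix `P` with
`pP = p`, the Markov measure `μ_{p,P}` satisfies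
`A(p,P) = ∫ Φ d(μ_{p,P})^{⊗r} = ∏_k ∑_{i,j} φ_k(i,j) p_i p_{i,j}`; and for every `α` with
`E_Φ(α) ≠ ∅`, `h_top(E_Φ(α)) = max { H_2(p,P) : A(p,P) = α }`, where
`H_2(p,P) = -∑_i p_i ∑_j p_{i,j} log p_{i,j}`. -/
theorem htop_Eset_eq_max_entropy_markov
    (m : ℕ) (hm : 2 ≤ m) (r : ℕ) (hr : 1 ≤ r)
    (φ : Fin r → Fin m → Fin m → ℝ)
    (Φ : (Fin r → (ℕ → Fin m)) → ℝ)
    (hΦ : Φ = fun x => ∏ k : Fin r, φ k (x k 0) (x k 1)) :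
    (∀ (p : Fin m → ℝ) (P : Fin m → Fin m → ℝ),
      (∀ i, 0 ≤ p i) → ∑ i, p i = 1 →
      (∀ i j, 0 ≤ P i j) → (∀ i, ∑ j, P i j = 1) →
      (∀ j, ∑ i, p i * P i j = p j) →
      ∀ μ : Measure (ℕ → Fin m), IsProbabilityMeasure μ →
        (∀ (n : ℕ) (w : Fin (n + 1) → Fin m),
          μ {x : ℕ → Fin m | ∀ i : Fin (n + 1), x (i : ℕ) = w i} =
            ENNReal.ofReal (p (w 0) * ∏ i : Fin n, P (w i.castSucc) (w i.succ))) →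
        ∫ y, Φ y ∂(Measure.pi fun _ : Fin r => μ) =
          ∏ k : Fin r, ∑ i : Fin m, ∑ j : Fin m, φ k i j * (p i * P i j)) ∧
    (∀ α : ℝ, (Eset (shift m) Φ α).Nonempty →
      ∃ (p : Fin m → ℝ) (P : Fin m → Fin m → ℝ),
        (∀ i, 0 ≤ p i) ∧ ∑ i, p i = 1 ∧
        (∀ i j, 0 ≤ P i j) ∧ (∀ i, ∑ j, P i j = 1) ∧
        (∀ j, ∑ i, p i * P i j = p j) ∧
        (∏ k : Fin r, ∑ i : Fin m, ∑ j : Fin m, φ k i j * (p i * P i j)) = α ∧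
        htop (shift m) (Eset (shift m) Φ α) =
          ENNReal.ofReal (∑ i : Fin m, p i * ∑ j : Fin m, Real.negMulLog (P i j)) ∧
        ∀ (q : Fin m → ℝ) (Q : Fin m → Fin m → ℝ),
          (∀ i, 0 ≤ q i) → ∑ i, q i = 1 →
          (∀ i j, 0 ≤ Q i j) → (∀ i, ∑ j, Q i j = 1) →
          (∀ j, ∑ i, q i * Q i j = q j) →
          (∏ k : Fin r, ∑ i : Fin m, ∑ j : Fin m, φ k i j * (q i * Q i j)) = α →
          ∑ i : Fin m, q i * ∑ j : Fin m, Real.negMulLog (Q i j) ≤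
            ∑ i : Fin m, p i * ∑ j : Fin m, Real.negMulLog (P i j)) := by

  refine ⟨?_, ?_⟩
  · intro p P hp hp1 hP hP1 hst μ hμ1 hμ
    subst hΦ
    rw [MeasureTheory.integral_fintype_prod_eq_prod (μ := fun _ => μ)
      (f := fun k (x : ℕ → Fin m) => φ k (x 0) (x 1))]
    exact Finset.prod_congr rfl fun k _ => integral_two_coord hp hP μ hμ1 hμ (φ k)
  · intro α hne
    obtain ⟨p, P, hp, hp1, hP, hP1, hst, hA, hmax⟩ := exists_max hm φ hΦ hne
    refine ⟨p, P, hp, hp1, hP, hP1, hst, hA, ?_, ?_⟩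
    · refine le_antisymm ?_ (lower_bound hm φ hΦ hp hp1 hP hP1 hst hA)
      exact upper_bound ⟨0, by omega⟩ φ hΦ (H2_nonneg hp hP hP1) hmax
    · intro q Q hq hq1 hQ hQ1 hqst hqA
      have h := pair_mem hq hq1 hQ hQ1 hqst hqA
      have h2 := hmax _ h.1 h.2
      rw [Hent_eq_H2 hQ1] at h2
      exact h2

end Shift
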